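/- There exist a finite alphabet α, a state B ∈ α, and a cellular automaton Φ : α^ℤ → α^ℤ with quiescent state B such that Φ is not nilpotent, yet for every configuration x ∈ α^ℤ the closure (in the product topology) of the forward orbit {Φ^n(x) : n ∈ ℕ} contains the constant-B configuration B^∞. -/

import Mathlib

namespace SSCA

inductive Op | M (d : Bool) | cmp | pass
  deriving DecidableEq, Fintype
inductive Kind | solo (din dout : Bool) | hv (g : Op)
  deriving DecidableEq, Fintype
inductive Cls | dead | solo (din dout : Bool) | cross (g : Op)
  deriving DecidableEq

abbrev P := Kind × Fin 13 × Fin 11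
abbrev D := P × Kind
abbrev C := P × D

def k0 : Kind := .solo true true

/-- micro paths: first argument `true` for l1, second `true` for same direction -/
def path : Bool → Bool → List ℕ
  | true, true => [2,3,4,5,6,7,8,7,8,9,8,9,10,9]
  | true, false => [2,3,4,5,6,7,8,7,6,5,4,3,2,1]
  | false, true => [2,1,0,1,2,3,4,5,6,7,6,7,8,9]
  | false, false => [2,1,0,1,2,3,4,5,4,3,2,1,0,1]

/-- the direction of the move from time `j` to `j+1` -/
def mv (l : List ℕ) (j : ℕ) : Bool := Nat.blt (l.getD j 0) (l.getD (j+1) 0)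

def mir (d : Bool) (a : ℕ) : ℕ := if d then a else 10 - a

/-- status of position (j,a) on a path, mirrored when `d = false` -/
def onp (l : List ℕ) (d : Bool) (j a : ℕ) : Option (Bool × Bool) :=
  if Nat.beq (l.getD j 0) (mir d a) then some (mv l (j-1) == d, mv l j == d) else none

def solo1 : Option (Bool × Bool) → Cls
  | some (u, v) => .solo u v
  | none => .dead

def clsN : Kind → ℕ → ℕ → Cls
  | .solo d d', j, a =>
      solo1 ((onp (path true (d == d')) d j a).or (onp (path false (d == d')) d j a))
  | .hv g, j, a =>
      if Nat.beq j 3 && Nat.beq a 5 then .cross .cmp else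
      if Nat.beq j 5 && (Nat.beq a 7 || Nat.beq a 3) then .cross .pass else
      if Nat.beq j 7 && Nat.beq a 5 then .cross g else
      solo1 (((onp (path true true) true j a).or (onp (path false true) true j a)).or
        ((onp (path true true) false j a).or (onp (path false true) false j a)))

def am (d : Bool) : Fin 11 := if d then 2 else 8

def Lm (d : Bool) : P := (k0, 0, am d)

def isM (p : P) : Option Bool :=
  if p = Lm true then some true else if p = Lm false then some false else none

def cls (p : P) : Cls :=
  match p with
  | (κ, j, a) =>
    if j = 0 then
      match isM p with
      | some d => .cross (.M d)
      | none => .dead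
    else clsN κ j.val a.val

def mvA (a : Fin 11) (d : Bool) : Fin 11 := if d then a + 1 else a - 1

def adv (p : P) (d : Bool) : P :=
  match p with
  | (κ, j, a) =>
    if j = 12 then
      if mvA a d = 9 then Lm true else if mvA a d = 1 then Lm false else (k0, 0, 0)
    else (κ, j + 1, mvA a d)

def disp (d : Bool) (π : P) : Option Kind :=
  match cls π with
  | .solo din dout => if din = d then some (.solo d dout) else none
  | .cross g => some (.hv g)
  | .dead => none

def kd (p : P) (c : Bool → D) : Option Kind :=
  match isM p with
  | some d => disp d (c (!d)).1
  | none => some k0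

def outLab (p : P) (κ : Kind) (e : Bool) : P :=
  match isM p with
  | some d => (κ, 1, mvA (am d) e)
  | none => adv p e

def kinfo (d : Bool) (π : P) (δ : D) : Option Kind :=
  match isM π with
  | some d' => if d' = !d then disp d' δ.1 else some k0
  | none => some k0

def opc : Op → (Bool → D) → Option (Bool → D)
  | .M d, c =>
    match cls (c (!d)).1 with
    | .solo din dout =>
      if din = d then some (fun e => if e = dout then (adv (c (!d)).1 dout, k0) else c d)
      else none
    | .cross _ => (kinfo d (c (!d)).1 (c d)).map
        (fun k e => if e = d then ((c (!d)).1, k) else c d)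
    | .dead => none
  | .cmp, c =>
    if (c true).1 = (c false).1 then
      some (fun e => (outLab (c true).1
        (match isM (c true).1 with
          | some d' => (c (!d')).2
          | none => k0) e, k0))
    else none
  | .pass, c => some c

def gate (p : P) (c : Bool → D) : Option (Bool → C) :=
  match cls p with
  | .cross g => (kd p c).bind fun κ => (opc g c).map fun o e => (outLab p κ e, o e)
  | _ => none

def sg (d : Bool) : ℤ := if d then 1 else -1

/-! table facts -/

def okOut (p : P) (e : Bool) : Bool :=
  match cls p with
  | .solo _ d' => d' == e
  | .cross _ => true
  | .dead => false

theorem tab_adv : ∀ (p : P) (e : Bool), okOut p e → isM p = none →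
    p.2.1.val ≠ 0 ∧ (p.2.1.val + 1 < 13 → adv p e = (p.1, p.2.1 + 1, mvA p.2.2 e) ∧
      ((mvA p.2.2 e).val : ℤ) = p.2.2.val + sg e) ∧
    (p.2.1.val = 12 → ∃ d, adv p e = Lm d ∧ mvA p.2.2 e = (if d then 9 else 1) ∧
       ((mvA p.2.2 e).val : ℤ) = p.2.2.val + sg e) := by
  decide +kernel

end SSCA

namespace SSCA

abbrev Dg := ℤ → ℤ → Bool → Option C

def SoloL (x : Dg) (t s : ℤ) (d e : Bool) : Prop :=
  ∃ p h, x t s d = some (p, h) ∧ cls p = .solo d e ∧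
    x (t + 1) (s + sg e) e = some (adv p e, h) ∧ x (t + 1) (s + sg (!e)) (!e) = none

def HvL (x : Dg) (t s : ℤ) (e : Bool) : Prop :=
  ∃ p c o, (∀ d, x t s d = some (p, c d)) ∧ gate p c = some o ∧
    x (t + 1) (s + sg e) e = some (o e)

def PredB (x : Dg) (t s : ℤ) (d e : Bool) : Prop :=
  SoloL x t s d e ∨ (HvL x t s e ∧ d = !e)

def Anc (x : Dg) (t s : ℤ) (d e : Bool) : Prop :=
  SoloL x t s d e ∨ HvL x t s e

def YD (x : Dg) : Prop :=
  ∀ t s e, x (t + 1) (s + sg e) e ≠ none → ∃ d, PredB x t s d e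

/-- edge with label `q` in the box with origin `(T,S)` -/
def E (x : Dg) (T S : ℤ) (q : P) (d : Bool) (h : D) : Prop :=
  x (T + q.2.1.val) (S + q.2.2.val - 5) d = some (q, h)

theorem gate_some {p : P} {c : Bool → D} {o : Bool → C} (h : gate p c = some o) :
    ∃ g κ o', cls p = .cross g ∧ kd p c = some κ ∧ opc g c = some o' ∧
      ∀ e, o e = (outLab p κ e, o' e) := by
  unfold gate at h
  split at h
  · rename_i g hg
    rcases hk : kd p c with _ | κ
    · simp [hk] at h
    · rcases ho : opc g c with _ | o'
      · simp [hk, ho] at h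
      · simp [hk, ho] at h
        exact ⟨g, κ, o', hg, rfl, ho, fun e => by rw [← h]⟩
  · simp at h

theorem isM_some {p : P} {d : Bool} (h : isM p = some d) : p = Lm d := by
  unfold isM at h
  split_ifs at h with h1 h2 <;> simp_all

theorem isM_Lm (d : Bool) : isM (Lm d) = some d := by cases d <;> decide
theorem cls_Lm (d : Bool) : cls (Lm d) = .cross (.M d) := by cases d <;> decide

theorem solo_isM {p : P} {d e : Bool} (h : cls p = .solo d e) : isM p = none := by
  rcases hm : isM p with _ | d'
  · rfl
  · rw [isM_some hm, cls_Lm] at h; simp at h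

theorem solo_okOut {p : P} {d e : Bool} (h : cls p = .solo d e) : okOut p e := by
  simp [okOut, h]

theorem cross_okOut {p : P} {g : Op} {e : Bool} (h : cls p = .cross g) : okOut p e := by
  simp [okOut, h]

/-- raw inversion -/
theorem back_raw {x : Dg} (hY : YD x) {t s : ℤ} {e : Bool} {q : P} {h : D}
    (hx : x (t + 1) (s + sg e) e = some (q, h)) :
    (∃ p d, x t s d = some (p, h) ∧ cls p = .solo d e ∧ q = adv p e ∧ SoloL x t s d e) ∨
    (∃ p c g o, (∀ d, x t s d = some (p, c d)) ∧ cls p = .cross g ∧ isM p = none ∧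
      opc g c = some o ∧ q = adv p e ∧ h = o e ∧ HvL x t s e) ∨
    (∃ d0 c o κ, (∀ d, x t s d = some (Lm d0, c d)) ∧ disp d0 (c (!d0)).1 = some κ ∧
      opc (.M d0) c = some o ∧ q = (κ, 1, mvA (am d0) e) ∧ h = o e ∧ HvL x t s e) := by
  obtain ⟨d, hd | ⟨hd, _⟩⟩ := hY t s e (by rw [hx]; simp)
  · obtain ⟨p, h', h1, h2, h3, h4⟩ := id hd
    rw [hx] at h3
    simp only [Option.some.injEq, Prod.mk.injEq] at h3
    left
    exact ⟨p, d, by rw [h1, h3.2], h2, h3.1, hd⟩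
  · right
    obtain ⟨p, c, o, h1, h2, h3⟩ := id hd
    obtain ⟨g, κ, o', hg, hk, ho, hoe⟩ := gate_some h2
    rw [hx, hoe] at h3
    simp only [Option.some.injEq, Prod.mk.injEq] at h3
    rcases hm : isM p with _ | d0
    · left
      refine ⟨p, c, g, o', h1, hg, hm, ho, ?_, h3.2, hd⟩
      rw [h3.1]; simp [outLab, hm]
    · right
      have hp := isM_some hm
      subst hp
      rw [cls_Lm] at hg
      cases hg
      refine ⟨d0, c, o', κ, h1, ?_, ho, ?_, h3.2, hd⟩
      · simpa [kd, hm] using hk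
      · rw [h3.1]; simp [outLab, hm]

def prv (q : P) (e : Bool) : P := (q.1, q.2.1 - 1, mvA q.2.2 (!e))

theorem mvA_mvA (a : Fin 11) (e : Bool) : mvA (mvA a e) (!e) = a := by
  revert a e; decide

theorem prv_adv {p : P} {e : Bool} (h1 : okOut p e) (h2 : isM p = none)
    (hj : (adv p e).2.1.val ≠ 0) : p = prv (adv p e) e ∧
      (p.2.1.val : ℤ) + 1 = (adv p e).2.1.val ∧
      (p.2.2.val : ℤ) + sg e = (adv p e).2.2.val := by
  obtain ⟨h3, h4, h5⟩ := tab_adv p e h1 h2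
  rcases Nat.lt_or_ge (p.2.1.val + 1) 13 with h | h
  · obtain ⟨h6, h7⟩ := h4 h
    rw [h6]
    refine ⟨?_, ?_, ?_⟩
    · simp [prv, mvA_mvA]
    · simp only
      rw [Fin.val_add_one_of_lt]
      · simp
      · rw [Fin.lt_def]; simp; omega
    · simp only; omega
  · obtain ⟨d, h6, _⟩ := h5 (by omega)
    rw [h6] at hj
    exact absurd rfl hj

theorem back {x : Dg} (hY : YD x) {T S : ℤ} {e : Bool} {q : P} {h : D}
    (hx : E x T S q e h) (hj : 2 ≤ q.2.1.val) :
    ((prv q e).2.1.val : ℤ) + 1 = q.2.1.val ∧ ((prv q e).2.2.val : ℤ) + sg e = q.2.2.val ∧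
    ((∃ d, cls (prv q e) = .solo d e ∧ E x T S (prv q e) d h ∧
      SoloL x (T + (prv q e).2.1.val) (S + (prv q e).2.2.val - 5) d e) ∨
     (∃ g c o, cls (prv q e) = .cross g ∧ (∀ d, E x T S (prv q e) d (c d)) ∧
      opc g c = some o ∧ h = o e ∧
      HvL x (T + (prv q e).2.1.val) (S + (prv q e).2.2.val - 5) e)) := by
  have hx' := hx
  unfold E at hx
  have e1 : T + (q.2.1.val : ℤ) = (T + (q.2.1.val : ℤ) - 1) + 1 := by ring
  have e2 : S + (q.2.2.val : ℤ) - 5 = (S + (q.2.2.val : ℤ) - 5 - sg e) + sg e := by ring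
  rw [e1, e2] at hx
  rcases back_raw hY hx with ⟨p, d, h1, h2, h3, h4⟩ | ⟨p, c, g, o, h1, h2, h3, h4, h5, h6, h7⟩ |
    ⟨d0, c, o, κ, h1, h2, h3, h4, h5, h6⟩
  · have := prv_adv (solo_okOut h2) (solo_isM h2) (by rw [← h3]; omega)
    rw [← h3] at this
    obtain ⟨g1, g2, g3⟩ := this
    have f1 : T + (q.2.1.val : ℤ) - 1 = T + p.2.1.val := by omega
    have f2 : S + (q.2.2.val : ℤ) - 5 - sg e = S + p.2.2.val - 5 := by omega
    rw [f1, f2] at h1 h4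
    rw [← g1]
    exact ⟨g2, g3, Or.inl ⟨d, h2, h1, h4⟩⟩
  · have := prv_adv (cross_okOut (e := e) h2) h3 (by rw [← h5]; omega)
    rw [← h5] at this
    obtain ⟨g1, g2, g3⟩ := this
    have f1 : T + (q.2.1.val : ℤ) - 1 = T + p.2.1.val := by omega
    have f2 : S + (q.2.2.val : ℤ) - 5 - sg e = S + p.2.2.val - 5 := by omega
    rw [f1, f2] at h1 h7
    rw [← g1]
    exact ⟨g2, g3, Or.inr ⟨g, c, o, h2, h1, h4, h6, h7⟩⟩
  · rw [h4] at hj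
    simp at hj

theorem am_mv (d e : Bool) : ((mvA (am d) e).val : ℤ) = (am d).val + sg e := by
  cases d <;> cases e <;> decide

theorem tab_j1 : ∀ (p : P) (e : Bool), okOut p e → isM p = none → (adv p e).2.1.val ≠ 1 := by
  decide +kernel

theorem backM {x : Dg} (hY : YD x) {T S : ℤ} {e : Bool} {q : P} {h : D}
    (hx : E x T S q e h) (hj : q.2.1.val = 1) :
    ∃ d0 c o, q.2.2 = mvA (am d0) e ∧ (∀ d, E x T S (Lm d0) d (c d)) ∧
      disp d0 (c (!d0)).1 = some q.1 ∧ opc (.M d0) c = some o ∧ h = o e ∧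
      HvL x T (S + (am d0).val - 5) e := by
  unfold E at hx
  have e1 : T + (q.2.1.val : ℤ) = T + 1 := by rw [hj]; rfl
  have e2 : S + (q.2.2.val : ℤ) - 5 = (S + (q.2.2.val : ℤ) - 5 - sg e) + sg e := by ring
  rw [e1, e2] at hx
  rcases back_raw hY hx with ⟨p, d, h1, h2, h3, h4⟩ | ⟨p, c, g, o, h1, h2, h3, h4, h5, h6, h7⟩ |
    ⟨d0, c, o, κ, h1, h2, h3, h4, h5, h6⟩
  · exact absurd (h3 ▸ hj) (tab_j1 p e (solo_okOut h2) (solo_isM h2))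
  · exact absurd (h5 ▸ hj) (tab_j1 p e (cross_okOut h2) h3)
  · subst h4
    have hm := am_mv d0 e
    have f2 : S + ((mvA (am d0) e).val : ℤ) - 5 - sg e = S + (am d0).val - 5 := by omega
    simp only [f2] at h1 h6
    refine ⟨d0, c, o, rfl, ?_, h2, h3, h5, h6⟩
    intro d
    have := h1 d
    simpa [E, Lm] using this

def fin9 (d : Bool) : Fin 11 := if d then 9 else 1

theorem tab_j0 : ∀ (p : P) (e d : Bool), okOut p e → isM p = none → adv p e = Lm d →
    p.2.1 = 12 ∧ p.2.2 = mvA (fin9 d) (!e) ∧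
    (p.2.2.val : ℤ) + sg e = (am d).val + 7 * sg d ∧ okOut p (!e) = false := by
  decide +kernel

theorem tab_c12 : ∀ (p : P), p.2.1 = 12 → ∀ g, cls p ≠ .cross g := by
  have : ∀ p : P, p.2.1 = 12 → (match cls p with | .cross _ => false | _ => true) = true := by
    decide +kernel
  intro p hp g hg
  have := this p hp
  simp [hg] at this

theorem back0 {x : Dg} (hY : YD x) {T S : ℤ} {e d : Bool} {h : D}
    (hx : x (T + 13) (S + 7 * sg d + (am d).val - 5) e = some (Lm d, h)) :
    ∃ κ d', cls (κ, 12, mvA (fin9 d) (!e)) = .solo d' e ∧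
      E x T S (κ, 12, mvA (fin9 d) (!e)) d' h ∧
      ((mvA (fin9 d) (!e)).val : ℤ) + sg e = (am d).val + 7 * sg d ∧
      SoloL x (T + 12) (S + (mvA (fin9 d) (!e)).val - 5) d' e := by
  have e1 : T + 13 = (T + 12) + 1 := by ring
  have e2 : S + 7 * sg d + (am d).val - 5 =
    (S + 7 * sg d + (am d).val - 5 - sg e) + sg e := by ring
  rw [e1, e2] at hx
  rcases back_raw hY hx with ⟨p, d', h1, h2, h3, h4⟩ | ⟨p, c, g, o, h1, h2, h3, h4, h5, h6, h7⟩ |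
    ⟨d0, c, o, κ, h1, h2, h3, h4, h5, h6⟩
  · obtain ⟨g1, g2, g3, -⟩ := tab_j0 p e d (solo_okOut h2) (solo_isM h2) h3.symm
    have f2 : S + 7 * sg d + ((am d).val : ℤ) - 5 - sg e = S + p.2.2.val - 5 := by omega
    rw [f2] at h1 h4
    obtain ⟨κ, j, a⟩ := p
    simp only at g1 g2
    subst g1 g2
    exact ⟨κ, d', h2, h1, g3, h4⟩
  · obtain ⟨g1, -⟩ := tab_j0 p e d (cross_okOut h2) h3 h5.symm
    exact absurd h2 (tab_c12 p g1 g)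
  · simp [Lm] at h4

/-! backward runs -/

def slotOf (p : P) (e : Bool) : Bool :=
  match cls p with
  | .solo d _ => d
  | _ => !e

def bstep (q : P × Bool) : P × Bool := (prv q.1 q.2, slotOf (prv q.1 q.2) q.2)

def isS (q : P × Bool) : Bool :=
  Nat.ble 2 q.1.2.1.val && (match cls (prv q.1 q.2) with | .solo _ _ => true | _ => false)

def soloN : ℕ → P × Bool → Bool
  | 0, _ => true
  | n + 1, q => isS q && soloN n (bstep q)

theorem srun {x : Dg} (hY : YD x) {T S : ℤ} {h : D} : ∀ (n : ℕ) (q : P × Bool),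
    E x T S q.1 q.2 h → soloN n q = true →
    E x T S (bstep^[n] q).1 (bstep^[n] q).2 h := by
  intro n
  induction n with
  | zero => intro q hq _; exact hq
  | succ n ih =>
    intro q hq hs
    simp only [soloN, Bool.and_eq_true, isS] at hs
    obtain ⟨⟨h1, h2⟩, h3⟩ := hs
    rw [Function.iterate_succ_apply]
    apply ih _ _ h3
    obtain ⟨-, -, ⟨d, k1, k2, k3⟩ | ⟨g, c, o, k1, -⟩⟩ := back hY hq (Nat.le_of_ble_eq_true h1)
    · simpa [bstep, slotOf, k1] using k2
    · simp [k1] at h2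

def c0 (κ : Kind) (d e : Bool) : P × Bool :=
  ((κ, 12, mvA (fin9 d) (!e)), slotOf (κ, 12, mvA (fin9 d) (!e)) e)

theorem E_inj {x : Dg} {T S : ℤ} {q q' : P} {d : Bool} {h h' : D}
    (h1 : E x T S q d h) (h2 : E x T S q' d h')
    (hj : q.2.1 = q'.2.1) (ha : q.2.2 = q'.2.2) : q = q' ∧ h = h' := by
  unfold E at h1 h2
  rw [hj, ha, h2] at h1
  simp at h1
  exact ⟨h1.1.symm, h1.2.symm⟩

/-- live arrival edge of kind κ -/
def Arr (x : Dg) (T S : ℤ) (κ : Kind) (d e : Bool) (h : D) : Prop :=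
  okOut (c0 κ d e).1 e ∧ E x T S (c0 κ d e).1 (c0 κ d e).2 h ∧
  ((mvA (fin9 d) (!e)).val : ℤ) + sg e = (am d).val + 7 * sg d ∧
      SoloL x (T + 12) (S + (mvA (fin9 d) (!e)).val - 5) (c0 κ d e).2 e

theorem back0' {x : Dg} (hY : YD x) {T S : ℤ} {e d : Bool} {h : D}
    (hx : x (T + 13) (S + 7 * sg d + (am d).val - 5) e = some (Lm d, h)) :
    ∃ κ, Arr x T S κ d e h := by
  obtain ⟨κ, d', h1, h2, h3, h4⟩ := back0 hY hx
  refine ⟨κ, solo_okOut h1, ?_, h3, ?_⟩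
  · simpa [c0, slotOf, h1] using h2
  · simpa [c0, slotOf, h1] using h4

end SSCA

namespace SSCA

theorem tab_solo : ∀ D d1 d e, okOut (c0 (.solo D d1) d e).1 e → d1 = d ∧
    soloN 11 (c0 (.solo D d1) d e) = true ∧
    bstep^[11] (c0 (.solo D d1) d e) = ((.solo D d1, 1, mvA (am D) (!e)), !e) := by
  decide +kernel

theorem tab_hv1 : ∀ g d, soloN 4 (c0 (.hv g) d d) = true ∧
    bstep^[4] (c0 (.hv g) d d) = ((.hv g, 8, mvA 5 d), d) ∧
    prv (.hv g, 8, mvA 5 d) d = (.hv g, 7, 5) ∧ cls (.hv g, 7, 5) = .cross g := by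
  decide +kernel

def a5 (d : Bool) : Fin 11 := if d then 7 else 3

theorem tab_hv2 : ∀ g f, soloN 1 ((.hv g, 7, 5), f) = true ∧
    bstep^[1] ((.hv g, 7, 5), f) = ((.hv g, 6, mvA 5 (!f)), f) ∧
    prv (.hv g, 6, mvA 5 (!f)) f = (.hv g, 5, a5 (!f)) ∧
    cls (.hv g, 5, a5 (!f)) = .cross .pass ∧
    soloN 4 ((.hv g, 5, a5 (!f)), f) = true ∧
    bstep^[4] ((.hv g, 5, a5 (!f)), f) = ((.hv g, 1, mvA (am f) (!f)), !f) := by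
  decide +kernel

theorem tab_hv3 : ∀ g d, soloN 6 (c0 (.hv g) d (!d)) = true ∧
    bstep^[6] (c0 (.hv g) d (!d)) = ((.hv g, 6, mvA (a5 d) d), d) ∧
    prv (.hv g, 6, mvA (a5 d) d) d = (.hv g, 5, a5 d) ∧
    cls (.hv g, 5, a5 d) = .cross .pass ∧
    soloN 1 ((.hv g, 5, a5 d), d) = true ∧
    bstep^[1] ((.hv g, 5, a5 d), d) = ((.hv g, 4, mvA 5 d), d) ∧
    prv (.hv g, 4, mvA 5 d) d = (.hv g, 3, 5) ∧ cls (.hv g, 3, 5) = .cross .cmp := by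
  decide +kernel

theorem tab_hv4 : ∀ g f, soloN 2 ((.hv g, 3, 5), f) = true ∧
    bstep^[2] ((.hv g, 3, 5), f) = ((.hv g, 1, mvA (am f) f), f) := by
  decide +kernel

def MS (x : Dg) (T S : ℤ) (d : Bool) (c : Bool → D) : Prop := ∀ e, E x T S (Lm d) e (c e)

theorem MS_inj {x : Dg} {T S : ℤ} {d : Bool} {c c' : Bool → D} (h : MS x T S d c)
    (h' : MS x T S d c') : c = c' := by
  funext e
  exact (E_inj (h e) (h' e) rfl rfl).2

theorem am_inj : ∀ d D e, mvA (am d) e = mvA (am D) e → d = D := by decide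

theorem mtrace {x : Dg} (hY : YD x) {T S : ℤ} {κ : Kind} {D e : Bool} {h : SSCA.D}
    (hx : E x T S (κ, 1, mvA (am D) e) e h) :
    ∃ c o, MS x T S D c ∧ disp D (c (!D)).1 = some κ ∧ opc (.M D) c = some o ∧ h = o e := by
  obtain ⟨d0, c, o, h1, h2, h3, h4, h5, -⟩ := backM hY hx rfl
  have := am_inj _ _ _ h1
  subst this
  exact ⟨c, o, h2, h3, h4, h5⟩

theorem opcM_solo {D d : Bool} {c o : Bool → SSCA.D} (h1 : disp D (c (!D)).1 = some (.solo D d))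
    (h2 : opc (.M D) c = some o) : cls (c (!D)).1 = .solo D d ∧
      o d = (adv (c (!D)).1 d, k0) ∧ o (!d) = c D := by
  unfold disp at h1
  unfold opc at h2
  split at h1
  · rename_i u v huv
    split_ifs at h1 with hu
    simp only [Option.some.injEq, Kind.solo.injEq, true_and] at h1
    subst hu h1
    simp only [huv, if_true, Option.some.injEq] at h2
    subst h2
    exact ⟨huv, by simp, by simp⟩
  · simp at h1
  · simp at h1

theorem opcM_hv {D : Bool} {g : Op} {c o : Bool → SSCA.D}
    (h1 : disp D (c (!D)).1 = some (.hv g))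
    (h2 : opc (.M D) c = some o) : cls (c (!D)).1 = .cross g ∧
      ∃ k, kinfo D (c (!D)).1 (c D) = some k ∧ o D = ((c (!D)).1, k) ∧ o (!D) = c D := by
  unfold disp at h1
  unfold opc at h2
  split at h1
  · rename_i u v huv
    split_ifs at h1 with hu
    simp at h1
  · rename_i g' hg
    simp only [Option.some.injEq, Kind.hv.injEq] at h1
    subst h1
    simp only [hg, Option.map_eq_some_iff] at h2
    obtain ⟨k, hk, rfl⟩ := h2
    exact ⟨hg, k, hk, by simp, by simp⟩
  · simp at h1

theorem solo_tr {x : Dg} (hY : YD x) {T S : ℤ} {D d1 d e : Bool} {h : SSCA.D}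
    (hx : Arr x T S (.solo D d1) d e h) : d1 = d ∧ ∃ c o, MS x T S D c ∧
      disp D (c (!D)).1 = some (.solo D d) ∧ opc (.M D) c = some o ∧ h = o (!e) := by
  obtain ⟨h1, h2, -⟩ := hx
  obtain ⟨t1, t2, t3⟩ := tab_solo D d1 d e h1
  have := srun hY 11 _ h2 t2
  rw [t3] at this
  subst t1
  exact ⟨rfl, mtrace hY this⟩

theorem hv_tr1 {x : Dg} (hY : YD x) {T S : ℤ} {g : Op} {d : Bool} {h : SSCA.D}
    (hx : Arr x T S (.hv g) d d h) : ∃ c : Bool → Bool → SSCA.D, (∀ f, MS x T S f (c f)) ∧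
      (∀ f, disp f (c f (!f)).1 = some (.hv g)) ∧ (∀ f, cls (c f (!f)).1 = .cross g) ∧
      ∃ o, opc g (fun f => c f f) = some o ∧ h = o d := by
  obtain ⟨h1, h2, -⟩ := hx
  obtain ⟨t1, t2, t3, t4⟩ := tab_hv1 g d
  have k1 := srun hY 4 _ h2 t1
  rw [t2] at k1
  obtain ⟨-, -, ⟨d', m1, -⟩ | ⟨g', c7, o, m1, m2, m3, m4, -⟩⟩ := back hY k1 (by simp)
  · simp only [t3, t4] at m1; simp at m1
  simp only [t3] at m1 m2
  rw [t4] at m1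
  cases m1
  have key : ∀ f, ∃ c o, MS x T S f c ∧ disp f (c (!f)).1 = some (.hv g) ∧
      opc (.M f) c = some o ∧ c7 f = o (!f) := by
    intro f
    obtain ⟨t1, t2, t3, t4, t5, t6⟩ := tab_hv2 g f
    have k1 := srun hY 1 ((.hv g, 7, 5), f) (m2 f) t1
    rw [t2] at k1
    obtain ⟨-, -, ⟨d', m1, -⟩ | ⟨g', c5, o5, m1, m2, m3, m4, -⟩⟩ := back hY k1 (by simp)
    · simp only [t3, t4] at m1; simp at m1
    simp only [t3] at m1 m2
    rw [t4] at m1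
    cases m1
    simp only [opc, Option.some.injEq] at m3
    have k2 := srun hY 4 ((.hv g, 5, a5 (!f)), f) (m2 f) t5
    rw [t6] at k2
    rw [m4, ← m3]
    exact mtrace hY k2
  choose c oM q1 q2 q3 q4 using key
  refine ⟨c, q1, q2, fun f => (opcM_hv (q2 f) (q3 f)).1, o, ?_, m4⟩
  rw [← m3]
  congr 1
  funext f
  obtain ⟨-, k, -, -, r⟩ := opcM_hv (q2 f) (q3 f)
  rw [q4, r]

theorem hv_tr2 {x : Dg} (hY : YD x) {T S : ℤ} {g : Op} {d : Bool} {h : SSCA.D}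
    (hx : Arr x T S (.hv g) d (!d) h) : ∃ c : Bool → Bool → SSCA.D, (∀ f, MS x T S f (c f)) ∧
      (∀ f, disp f (c f (!f)).1 = some (.hv g)) ∧ ∃ k : Bool → Kind,
      (∀ f, kinfo f (c f (!f)).1 (c f f) = some (k f)) ∧ (c true false).1 = (c false true).1 ∧
      h.1 = outLab (c true false).1 (match isM (c true false).1 with
          | some d' => k (!d')
          | none => k0) d := by
  obtain ⟨h1, h2, -⟩ := hx
  obtain ⟨t1, t2, t3, t4, t5, t6, t7, t8⟩ := tab_hv3 g d
  have k1 := srun hY 6 _ h2 t1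
  rw [t2] at k1
  obtain ⟨-, -, ⟨d', m1, -⟩ | ⟨g', c5, o, m1, m2, m3, m4, -⟩⟩ := back hY k1 (by simp)
  · simp only [t3, t4] at m1; simp at m1
  simp only [t3] at m1 m2
  rw [t4] at m1
  cases m1
  simp only [opc, Option.some.injEq] at m3
  subst m3
  have k2 := srun hY 1 ((.hv g, 5, a5 d), d) (m2 d) t5
  rw [t6] at k2
  obtain ⟨-, -, ⟨d', m1, -⟩ | ⟨g', c3, o, m1', m2', m3', m4', -⟩⟩ := back hY k2 (by simp)
  · simp only [t7, t8] at m1; simp at m1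
  simp only [t7] at m1' m2'
  rw [t8] at m1'
  cases m1'
  have key : ∀ f, ∃ c o, MS x T S f c ∧ disp f (c (!f)).1 = some (.hv g) ∧
      opc (.M f) c = some o ∧ c3 f = o f := by
    intro f
    obtain ⟨t1, t2⟩ := tab_hv4 g f
    have k1 := srun hY 2 ((.hv g, 3, 5), f) (m2' f) t1
    rw [t2] at k1
    exact mtrace hY k1
  choose c oM q1 q2 q3 q4 using key
  have key2 := fun f => (opcM_hv (q2 f) (q3 f)).2
  choose k r1 r2 r3 using key2
  refine ⟨c, q1, q2, k, r1, ?_, ?_⟩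
  · have e1 := q4 true
    have e2 := q4 false
    rw [r2] at e1 e2
    simp only [opc] at m3'
    split_ifs at m3' with hh
    simpa [e1, e2] using hh
  · have e1 := q4 true
    have e2 := fun f => q4 f
    simp only [r2] at e1 e2
    simp only [opc] at m3'
    split_ifs at m3' with hh
    simp only [Option.some.injEq] at m3'
    rw [m4, m4', ← m3']
    simp only [e2, Bool.not_true]
    all_goals (rcases isM (c true false).1 <;> rfl)

theorem tab_x1 : ∀ D d1,
    soloN 8 (c0 (.solo D d1) d1 (!D)) = true ∧
    bstep^[8] (c0 (.solo D d1) d1 (!D)) = ((.solo D d1, 4, mvA 5 D), D) ∧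
    prv (.solo D d1, 4, mvA 5 D) D = (.solo D d1, 3, 5) ∧
    cls (.solo D d1, 3, 5) = .solo D D := by
  decide +kernel

theorem tab_x2 : ∀ D d,
    soloN 4 (c0 (.solo D d) d (D)) = true ∧
    bstep^[4] (c0 (.solo D d) d (D)) = ((.solo D d, 8, mvA 5 d), d) := by
  decide +kernel

theorem SoloL_not {x : Dg} {t s : ℤ} {d d' e : Bool} (h : SoloL x t s d e)
    (h' : SoloL x t s d' (!e)) : False := by
  obtain ⟨p, k, h1, h2, h3, h4⟩ := h
  obtain ⟨p', k', h1', h2', h3', h4'⟩ := h'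
  rw [h4] at h3'
  simp at h3'

/-- both solo kinds from different sides cannot coexist -/
theorem noX1 {x : Dg} (hY : YD x) {T S : ℤ} {D d1 d2 : Bool} {h h' : SSCA.D}
    (h1 : Arr x T S (.solo D d1) d1 (!D) h) (h2 : Arr x T S (.solo (!D) d2) d2 D h') :
    False := by
  have key : ∀ D d h, Arr x T S (.solo D d) d (!D) h → SoloL x (T + 3) (S + 5 - 5) D D := by
    intro D d h hx
    obtain ⟨t1, t2, t3, t4⟩ := tab_x1 D d
    have k1 := srun hY 8 _ hx.2.1 t1
    rw [t2] at k1
    obtain ⟨-, -, ⟨d', m1, m2, m3⟩ | ⟨g', c5, o, m1, -⟩⟩ := back hY k1 (by simp)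
    · simp only [t3, t4] at m1 m3
      simp only [Cls.solo.injEq, and_true] at m1
      subst m1
      exact m3
    · simp only [t3, t4] at m1; simp at m1
  exact SoloL_not (key _ _ _ h1) (key (!D) d2 h' (by simpa using h2))

theorem noX2 {x : Dg} (hY : YD x) {T S : ℤ} {D d : Bool} {h h' : SSCA.D}
    (h1 : Arr x T S (.solo D d) d D h) (h2 : Arr x T S (.solo (!D) d) d (!D) h') :
    False := by
  obtain ⟨t1, t2⟩ := tab_x2 D d
  obtain ⟨t3, t4⟩ := tab_x2 (!D) d
  have k1 := srun hY 4 _ h1.2.1 t1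
  have k2 := srun hY 4 _ h2.2.1 t3
  rw [t2] at k1
  rw [t4] at k2
  have := (E_inj k1 k2 rfl rfl).1
  simp at this

def inv : Kind → Bool → Prop
  | .solo D _, D' => D = D'
  | .hv _, _ => True

theorem src {x : Dg} (hY : YD x) {T S : ℤ} {κ : Kind} {d e : Bool} {h : SSCA.D}
    (hx : Arr x T S κ d e h) (D : Bool) (hD : inv κ D) :
    ∃ c, MS x T S D c ∧ disp D (c (!D)).1 = some κ := by
  rcases κ with ⟨D', d1⟩ | g
  · simp only [inv] at hD
    subst hD
    obtain ⟨rfl, c, o, h1, h2, -⟩ := solo_tr hY hx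
    exact ⟨c, h1, h2⟩
  · by_cases hed : e = d
    · subst hed
      obtain ⟨c, h1, h2, -⟩ := hv_tr1 hY hx
      exact ⟨c D, h1 D, h2 D⟩
    · have : e = !d := by cases e <;> cases d <;> simp_all
      subst this
      obtain ⟨c, h1, h2, -⟩ := hv_tr2 hY hx
      exact ⟨c D, h1 D, h2 D⟩

theorem src_eq {x : Dg} (hY : YD x) {T S : ℤ} {κ κ' : Kind} {d e d' e' : Bool} {h h' : SSCA.D}
    (hx : Arr x T S κ d e h) (hx' : Arr x T S κ' d' e' h') (D : Bool) (hD : inv κ D)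
    (hD' : inv κ' D) : κ = κ' := by
  obtain ⟨c, h1, h2⟩ := src hY hx D hD
  obtain ⟨c', h1', h2'⟩ := src hY hx' D hD'
  have := MS_inj h1 h1'
  subst this
  rw [h2] at h2'
  simpa using h2'

theorem common {x : Dg} (hY : YD x) {T S : ℤ} {κ κ' : Kind} {d : Bool} {h h' : SSCA.D}
    (hx : Arr x T S κ d d h) (hx' : Arr x T S κ' d (!d) h') : κ = κ' := by
  rcases κ with ⟨D, d1⟩ | g
  · rcases κ' with ⟨D', d2⟩ | g'
    · obtain ⟨rfl, -⟩ := solo_tr hY hx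
      obtain ⟨rfl, -⟩ := solo_tr hY hx'
      by_cases hDD : D = D'
      · rw [hDD]
      · exfalso
        have h1 : D' = !D := by cases D <;> cases D' <;> simp_all
        subst h1
        by_cases hd : D = d2
        · subst hd
          exact noX2 hY hx hx'
        · have h2 : D = !d2 := by cases D <;> cases d2 <;> simp_all
          subst h2
          exact noX1 hY (D := d2) (by simpa using hx') hx
    · exact src_eq hY hx hx' D rfl trivial
  · rcases κ' with ⟨D', d2⟩ | g'
    · exact src_eq hY hx hx' D' trivial rfl
    · exact src_eq hY hx hx' true trivial trivial

theorem mback {x : Dg} (hY : YD x) {T S : ℤ} {d : Bool} {h : Bool → SSCA.D}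
    (hx : ∀ e, x (T + 13) (S + 7 * sg d + (am d).val - 5) e = some (Lm d, h e)) :
    ∃ κ, (∀ e, Arr x T S κ d e (h e)) ∧
      ((∃ D c, κ = .solo D d ∧ MS x T S D c ∧ cls (c (!D)).1 = .solo D d ∧
        (h (!d)).1 = adv (c (!D)).1 d ∧ h d = c D) ∨
      (∃ g p o, ∃ c : Bool → Bool → SSCA.D, κ = .hv g ∧ (∀ f, MS x T S f (c f)) ∧
        (∀ f, (c f (!f)).1 = p) ∧ gate p (fun f => c f f) = some o ∧
        o d = ((h (!d)).1, h d))) := by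
  obtain ⟨κ, h1⟩ := back0' hY (hx d)
  obtain ⟨κ', h2⟩ := back0' hY (hx (!d))
  have hk := common hY h1 h2
  subst hk
  refine ⟨κ, ?_, ?_⟩
  · intro e
    by_cases hed : e = d
    · subst hed; exact h1
    · have : e = !d := by cases e <;> cases d <;> simp_all
      subst this; exact h2
  rcases κ with ⟨D, d1⟩ | g
  · left
    obtain ⟨rfl, c, o, k1, k2, k3, k4⟩ := solo_tr hY h1
    obtain ⟨-, c', o', k1', k2', k3', k4'⟩ := solo_tr hY h2
    have := MS_inj k1 k1'
    subst this
    rw [k3] at k3'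
    cases k3'
    obtain ⟨m1, m2, m3⟩ := opcM_solo k2 k3
    refine ⟨D, c, rfl, k1, m1, ?_, ?_⟩
    · rw [k4', Bool.not_not, m2]
    · rw [k4, m3]
  · right
    obtain ⟨c, k1, k2, k3, o, k4, k5⟩ := hv_tr1 hY h1
    obtain ⟨c', k1', k2', k, k3', k4', k5'⟩ := hv_tr2 hY h2
    have : c = c' := funext fun f => MS_inj (k1 f) (k1' f)
    subst this
    refine ⟨g, (c true false).1, fun e => (outLab (c true false).1
        (match isM (c true false).1 with
          | some d' => k (!d')
          | none => k0) e, o e), c, rfl, k1, ?_, ?_, ?_⟩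
    · intro f; cases f
      · exact k4'.symm
      · rfl
    · have hc := k3 true
      have hkd : kd (c true false).1 (fun f => c f f) = some (match isM (c true false).1 with
          | some d' => k (!d')
          | none => k0) := by
        unfold kd
        rcases hm : isM (c true false).1 with _ | d'
        · rfl
        · simp only
          have := k3' (!d')
          have hp : (c (!d') (!(!d'))).1 = (c true false).1 := by
            cases d'
            · rfl
            · exact k4'.symm
          rw [hp, kinfo, hm] at this
          simpa using this
      simp only [Bool.not_true] at hc
      unfold gate
      simp only [hc, hkd, k4]
      rfl
    · rw [k5', k5]

end SSCA

namespace SSCA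

open Classical in
noncomputable def mac (x : Dg) (o1 o2 : ℤ) : Dg := fun τ σ d =>
  if h : ∃ c, MS x (o1 + 13 * τ) (o2 + 7 * σ) d c then
    some ((h.choose (!d)).1, h.choose d) else none

theorem mac_of {x : Dg} {o1 o2 τ σ : ℤ} {d : Bool} {c : Bool → D}
    (h : MS x (o1 + 13 * τ) (o2 + 7 * σ) d c) :
    mac x o1 o2 τ σ d = some ((c (!d)).1, c d) := by
  have h' : ∃ c, MS x (o1 + 13 * τ) (o2 + 7 * σ) d c := ⟨c, h⟩
  have := MS_inj h'.choose_spec h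
  simp only [mac, dif_pos h', this]

theorem mac_live {x : Dg} {o1 o2 τ σ : ℤ} {d : Bool} (h : mac x o1 o2 τ σ d ≠ none) :
    ∃ c, MS x (o1 + 13 * τ) (o2 + 7 * σ) d c := by
  by_contra h'
  exact h (by simp only [mac, dif_neg h'])

theorem Lm_E {x : Dg} {T S : ℤ} {d e : Bool} {h : D} :
    E x T S (Lm d) e h ↔ x T (S + (am d).val - 5) e = some (Lm d, h) := by
  simp [E, Lm]

def Dof : Kind → Bool → Bool
  | .solo D _, _ => D
  | .hv _, d => !d

theorem mac_next {x : Dg} {o1 o2 τ σ : ℤ} {d : Bool}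
    (h : mac x o1 o2 (τ + 1) (σ + sg d) d ≠ none) :
    ∃ c : Bool → D, (∀ e, x ((o1 + 13 * τ) + 13) ((o2 + 7 * σ) + 7 * sg d + (am d).val - 5) e =
      some (Lm d, c e)) ∧ mac x o1 o2 (τ + 1) (σ + sg d) d = some ((c (!d)).1, c d) := by
  obtain ⟨c, hc⟩ := mac_live h
  refine ⟨c, ?_, mac_of hc⟩
  intro e
  have := Lm_E.1 (hc e)
  rw [← this]
  congr 1 <;> ring

theorem macBack {x : Dg} (hY : YD x) {o1 o2 τ σ : ℤ} {d : Bool}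
    (hl : mac x o1 o2 (τ + 1) (σ + sg d) d ≠ none) :
    ∃ κ, (∃ h : Bool → D, ∀ e, Arr x (o1 + 13 * τ) (o2 + 7 * σ) κ d e (h e)) ∧
      ((κ = .solo (Dof κ d) d ∧ SoloL (mac x o1 o2) τ σ (Dof κ d) d) ∨
       ((∃ g, κ = .hv g) ∧ HvL (mac x o1 o2) τ σ d)) := by
  obtain ⟨h, h1, h2⟩ := mac_next hl
  obtain ⟨κ, k1, ⟨D, c, rfl, k3, k4, k5, k6⟩ | ⟨g, p, o, c, rfl, k3, k4, k5, k6⟩⟩ := mback hY h1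
  · refine ⟨_, ⟨h, k1⟩, Or.inl ⟨rfl, ?_⟩⟩
    refine ⟨(c (!D)).1, c D, mac_of k3, k4, ?_, ?_⟩
    · rw [h2, k5, k6]
    · by_contra hne
      obtain ⟨h', h1', h2'⟩ := mac_next hne
      obtain ⟨κ', k1', -⟩ := mback hY h1'
      rcases κ' with ⟨D', d'⟩ | g
      · obtain ⟨hd, -⟩ := solo_tr hY (k1' true)
        subst hd
        by_cases hDD : D = D'
        · subst hDD
          have := src_eq hY (k1 true) (k1' true) D rfl rfl
          simp at this
        · have : D' = !D := by cases D <;> cases D' <;> simp_all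
          subst this
          exact noX1 hY (k1 (!D)) (k1' D)
      · have := src_eq hY (k1 true) (k1' true) D rfl trivial
        simp at this
  · refine ⟨_, ⟨h, k1⟩, Or.inr ⟨⟨g, rfl⟩, ?_⟩⟩
    refine ⟨p, fun f => c f f, o, ?_, k5, ?_⟩
    · intro f
      rw [mac_of (k3 f), k4]
    · rw [h2, k6]

theorem mac_YD {x : Dg} (hY : YD x) (o1 o2 : ℤ) : YD (mac x o1 o2) := by
  intro τ σ d hl
  obtain ⟨κ, -, ⟨-, h⟩ | ⟨-, h⟩⟩ := macBack hY hl
  · exact ⟨_, Or.inl h⟩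
  · exact ⟨!d, Or.inr ⟨h, rfl⟩⟩

/-! uniqueness of PredB -/

theorem tab_slot : ∀ (p : P) (e d : Bool), okOut p e → isM p = none → adv p e = Lm d →
    slotOf p e = d := by
  decide +kernel

theorem PredB_uniq {x : Dg} {t s : ℤ} {D D' e : Bool} (h : PredB x t s D e)
    (h' : PredB x t s D' e) : D = D' := by
  rcases h with h | ⟨h, rfl⟩
  · obtain ⟨p, k, h1, h2, h3, h4⟩ := h
    rcases h' with h' | ⟨h', rfl⟩
    · obtain ⟨p', k', h1', h2', h3', h4'⟩ := h'
      rw [h3] at h3'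
      simp only [Option.some.injEq, Prod.mk.injEq] at h3'
      by_cases hj : (adv p e).2.1.val = 0
      · have key : ∀ (q : P) (f : Bool), cls q = .solo f e → (adv q e).2.1.val = 0 →
            ∃ d, adv q e = Lm d ∧ f = d := by
          intro q f hq hq0
          obtain ⟨g1, g2, g3⟩ := tab_adv q e (solo_okOut hq) (solo_isM hq)
          have hq12 : q.2.1.val = 12 := by
            by_contra hne
            have := (g2 (by omega)).1
            rw [this] at hq0
            simp only at hq0
            rw [Fin.val_add_one_of_lt] at hq0
            · omega
            · rw [Fin.lt_def]; simp; omega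
          obtain ⟨d, g4, -⟩ := g3 hq12
          refine ⟨d, g4, ?_⟩
          have := tab_slot q e d (solo_okOut hq) (solo_isM hq) g4
          simpa [slotOf, hq] using this
        obtain ⟨d, m1, rfl⟩ := key p D h2 hj
        obtain ⟨d', m1', rfl⟩ := key p' D' h2' (by rw [← h3'.1]; exact hj)
        rw [h3'.1, m1'] at m1
        cases D <;> cases D' <;> simp_all [Lm, am]
      · have g1 := (prv_adv (solo_okOut h2) (solo_isM h2) hj).1
        have g2 := (prv_adv (solo_okOut h2') (solo_isM h2') (by rw [← h3'.1]; exact hj)).1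
        rw [← h3'.1, ← g1] at g2
        rw [g2, h2] at h2'
        simpa using h2'
    · obtain ⟨p', c, o, h1', h2', -⟩ := h'
      obtain ⟨g, _, _, hg, _⟩ := gate_some h2'
      rw [h1'] at h1
      simp only [Option.some.injEq, Prod.mk.injEq] at h1
      rw [h1.1, h2] at hg
      simp at hg
  · rcases h' with h' | ⟨h', rfl⟩
    · obtain ⟨p, k, h1, h2, -⟩ := h'
      obtain ⟨p', c, o, h1', h2', -⟩ := h
      obtain ⟨g, _, _, hg, _⟩ := gate_some h2'
      rw [h1'] at h1
      simp only [Option.some.injEq, Prod.mk.injEq] at h1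
      rw [h1.1, h2] at hg
      simp at hg
    · rfl

theorem macPred {x : Dg} (hY : YD x) {o1 o2 τ σ : ℤ} {D d : Bool}
    (h : PredB (mac x o1 o2) τ σ D d) :
    ∃ κ, D = Dof κ d ∧ (∃ h : Bool → SSCA.D, ∀ e, Arr x (o1 + 13 * τ) (o2 + 7 * σ) κ d e (h e)) := by
  have hl : mac x o1 o2 (τ + 1) (σ + sg d) d ≠ none := by
    rcases h with ⟨_, _, _, _, h, _⟩ | ⟨⟨_, _, _, _, _, h⟩, _⟩ <;> rw [h] <;> simp
  obtain ⟨κ, k1, ⟨-, k2⟩ | ⟨⟨g, rfl⟩, k2⟩⟩ := macBack hY hl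
  · exact ⟨κ, PredB_uniq h (Or.inl k2), k1⟩
  · exact ⟨_, PredB_uniq h (Or.inr ⟨k2, rfl⟩), k1⟩

/-! chains -/

def pos (κ : Kind) (d e : Bool) (i : ℕ) : ℤ × Bool :=
  if i = 0 then ((am (Dof κ d)).val - 5, e) else
  if i ≤ 12 then
    (((bstep^[12 - i] (c0 κ d e)).1.2.2.val : ℤ) - 5, (bstep^[12 - i] (c0 κ d e)).2)
  else ((am d).val - 5 + 7 * sg d, e)

theorem tab_end : ∀ κ d e, okOut (c0 κ d e).1 e →
    (bstep^[11] (c0 κ d e)).1.2.2 = mvA (am (Dof κ d)) (!e) ∧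
    (bstep^[11] (c0 κ d e)).2 = !e := by
  decide +kernel

structure Chain (x : Dg) (T S : ℤ) (f : ℕ → ℤ × Bool) : Prop where
  link : ∀ i : ℕ, i < 13 → PredB x (T + i) (S + (f i).1) (f i).2 (f (i + 1)).2
  step : ∀ i : ℕ, i < 13 → (f (i + 1)).1 = (f i).1 + sg (f (i + 1)).2
  labl : ∀ i : ℕ, i < 13 → ∃ q h, q.2.1.val = i ∧ (q.2.2.val : ℤ) - 5 = (f i).1 ∧
    x (T + i) (S + (f i).1) (f i).2 = some (q, h)

theorem chain {x : Dg} (hY : YD x) {T S : ℤ} {κ : Kind} {d e : Bool} {h : D}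
    (hx : Arr x T S κ d e h) : Chain x T S (pos κ d e) := by
  obtain ⟨h1, h2, h3, h4⟩ := hx
  set B := fun k => bstep^[k] (c0 κ d e) with hB
  have hBs : ∀ k, B (k + 1) = bstep (B k) := fun k => Function.iterate_succ_apply' _ _ _
  have live : ∀ k, k ≤ 11 → (B k).1.2.1.val = 12 - k ∧ ∃ h, E x T S (B k).1 (B k).2 h := by
    intro k
    induction k with
    | zero => intro _; exact ⟨rfl, h, h2⟩
    | succ k ih =>
      intro hk
      obtain ⟨i1, h', i2⟩ := ih (by omega)
      obtain ⟨b1, b2, b3⟩ := back hY i2 (by omega)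
      rw [hBs]
      refine ⟨by simp only [bstep]; omega, ?_⟩
      rcases b3 with ⟨f, m1, m2, m3⟩ | ⟨g, c, o, m1, m2, -⟩
      · exact ⟨h', by simpa [bstep, slotOf, m1] using m2⟩
      · exact ⟨c (slotOf (prv (B k).1 (B k).2) (B k).2), m2 _⟩
  have lnk : ∀ k, k + 1 ≤ 11 →
      PredB x (T + (B (k + 1)).1.2.1.val) (S + (B (k + 1)).1.2.2.val - 5) (B (k + 1)).2 (B k).2 ∧
      ((B (k + 1)).1.2.2.val : ℤ) + sg (B k).2 = (B k).1.2.2.val := by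
    intro k hk
    obtain ⟨i1, h', i2⟩ := live k (by omega)
    obtain ⟨b1, b2, b3⟩ := back hY i2 (by omega)
    rw [hBs]
    refine ⟨?_, b2⟩
    rcases b3 with ⟨f, m1, m2, m3⟩ | ⟨g, c, o, m1, m2, _, _, m3⟩
    · left
      simpa [bstep, slotOf, m1] using m3
    · right
      exact ⟨m3, by simp [bstep, slotOf, m1]⟩
  obtain ⟨e1, e2⟩ := tab_end κ d e h1
  obtain ⟨l1, hh, l2⟩ := live 11 le_rfl
  obtain ⟨d0, c, o, n1, n2, n3, n4, n5, n6⟩ := backM hY l2 l1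
  simp only [hB] at n1 n6
  rw [e1, e2] at n1
  rw [e2] at n6
  have n7 := am_inj _ _ _ n1
  subst n7
  have p0 : pos κ d e 0 = (((am (Dof κ d)).val : ℤ) - 5, e) := rfl
  have pm : ∀ i, 1 ≤ i → i ≤ 12 → pos κ d e i = (((B (12 - i)).1.2.2.val : ℤ) - 5, (B (12 - i)).2) := by
    intro i hi hi'
    simp only [pos, hB]
    rw [if_neg (by omega), if_pos hi']
  have pe : pos κ d e 13 = (((am d).val : ℤ) - 5 + 7 * sg d, e) := rfl
  refine ⟨?_, ?_, ?_⟩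
  · intro i hi
    rcases Nat.eq_zero_or_pos i with rfl | hi0
    · rw [p0, pm 1 le_rfl (by omega)]
      simp only [hB, Nat.add_one_sub_one]
      rw [e2]
      right
      refine ⟨?_, by simp⟩
      simpa [add_sub_assoc] using n6
    · rcases Nat.lt_or_ge i 12 with hi1 | hi1
      · rw [pm i hi0 (by omega), pm (i + 1) (by omega) (by omega)]
        obtain ⟨q1, q2⟩ := lnk (12 - (i + 1)) (by omega)
        have : 12 - (i + 1) + 1 = 12 - i := by omega
        rw [this] at q1
        rw [(live (12 - i) (by omega)).1] at q1
        have hc : ((12 - (12 - i) : ℕ) : ℤ) = i := by omega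
        rw [hc, add_sub_assoc] at q1
        exact q1
      · have : i = 12 := by omega
        subst this
        rw [pm 12 (by omega) le_rfl, pe]
        left
        simpa [hB, c0, add_sub_assoc] using h4
  · intro i hi
    rcases Nat.eq_zero_or_pos i with rfl | hi0
    · rw [p0, pm 1 le_rfl (by omega)]
      simp only [hB]
      rw [show 12 - 1 = 11 from rfl, e2, e1]
      have := am_mv (Dof κ d) (!e)
      omega
    · rcases Nat.lt_or_ge i 12 with hi1 | hi1
      · rw [pm i hi0 (by omega), pm (i + 1) (by omega) (by omega)]
        obtain ⟨q1, q2⟩ := lnk (12 - (i + 1)) (by omega)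
        have : 12 - (i + 1) + 1 = 12 - i := by omega
        rw [this] at q2
        simp only
        omega
      · have : i = 12 := by omega
        subst this
        rw [pm 12 (by omega) le_rfl, pe]
        simp only [hB, c0, Nat.sub_self, Function.iterate_zero, id]
        omega
  · intro i hi
    rcases Nat.eq_zero_or_pos i with rfl | hi0
    · rw [p0]
      refine ⟨Lm (Dof κ d), c e, rfl, rfl, ?_⟩
      have := Lm_E.1 (n2 e)
      simpa [add_sub_assoc] using this
    · rw [pm i hi0 (by omega)]
      obtain ⟨q1, hq, q2⟩ := live (12 - i) (by omega)
      refine ⟨(B (12 - i)).1, hq, by omega, rfl, ?_⟩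
      unfold E at q2
      rw [q1] at q2
      have hc : ((12 - (12 - i) : ℕ) : ℤ) = i := by omega
      rw [hc, add_sub_assoc] at q2
      exact q2

theorem Chain.parity {x : Dg} {T S : ℤ} {f : ℕ → ℤ × Bool} (h : Chain x T S f)
    (h0 : (f 0).1 % 2 = 1) : ∀ i, i ≤ 13 → ((f i).1 + i) % 2 = 1 := by
  intro i
  induction i with
  | zero => intro _; simpa using h0
  | succ n ih =>
    intro hn
    have h1 := h.step n (by omega)
    have h2 := ih (by omega)
    have h3 : sg (f (n + 1)).2 = 1 ∨ sg (f (n + 1)).2 = -1 := by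
      unfold sg; split <;> simp
    push_cast
    omega

/-! CO -/

inductive CO (x : Dg) : ℤ → ℤ → Bool → ℤ → Bool → Prop
  | base (t s : ℤ) : x (t + 1) (s + sg false) false ≠ none → x (t + 1) (s + sg true) true ≠ none →
      CO x (t + 1) (s + sg false) false (s + sg true) true
  | step {t s1 d1 s2 d2 e1 e2} : CO x t s1 d1 s2 d2 → PredB x t s1 d1 e1 → PredB x t s2 d2 e2 →
      CO x (t + 1) (s1 + sg e1) e1 (s2 + sg e2) e2

theorem CO_cast {x : Dg} {t s1 s2 t' s1' s2' : ℤ} {d1 d2 : Bool} (h : CO x t s1 d1 s2 d2)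
    (h1 : t = t') (h2 : s1 = s1') (h3 : s2 = s2') : CO x t' s1' d1 s2' d2 := by
  subst h1 h2 h3; exact h

theorem CO_run {x : Dg} {T S1 S2 : ℤ} {f g : ℕ → ℤ × Bool} (hf : Chain x T S1 f)
    (hg : Chain x T S2 g) (i : ℕ)
    (h : CO x (T + i) (S1 + (f i).1) (f i).2 (S2 + (g i).1) (g i).2) :
    ∀ k, i + k ≤ 13 → CO x (T + (i + k : ℕ)) (S1 + (f (i + k)).1) (f (i + k)).2
      (S2 + (g (i + k)).1) (g (i + k)).2 := by
  intro k
  induction k with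
  | zero => intro _; exact h
  | succ k ih =>
    intro hk
    have h1 := CO.step (ih (by omega)) (hf.link _ (by omega)) (hg.link _ (by omega))
    have h2 := hf.step (i + k) (by omega)
    have h3 := hg.step (i + k) (by omega)
    have e1 : i + (k + 1) = i + k + 1 := rfl
    rw [e1]
    exact CO_cast h1 (by push_cast; ring) (by rw [h2]; ring) (by rw [h3]; ring)

theorem tab_pos8 : ∀ g d, pos (.hv g) d d 8 = (sg d, d) := by decide +kernel

theorem CO_mac {x : Dg} (hY : YD x) {o1 o2 τ σ1 σ2 : ℤ} {D1 D2 : Bool}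
    (h : CO (mac x o1 o2) τ σ1 D1 σ2 D2) :
    CO x (o1 + 13 * τ) (o2 + 7 * σ1 + ((am D1).val - 5)) false
      (o2 + 7 * σ2 + ((am D2).val - 5)) true := by
  induction h with
  | base t s h1 h2 =>
    have key : ∀ d, mac x o1 o2 (t + 1) (s + sg d) d ≠ none →
        mac x o1 o2 (t + 1) (s + sg (!d)) (!d) ≠ none →
        ∃ g, Chain x (o1 + 13 * t) (o2 + 7 * s) (pos (.hv g) d d) := by
      intro d h1 h2
      obtain ⟨κ, ⟨h, k1⟩, ⟨-, _, _, _, _, _, k2⟩ | ⟨⟨g, rfl⟩, k2⟩⟩ := macBack hY h1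
      · exact absurd k2 h2
      · exact ⟨g, chain hY (k1 d)⟩
    obtain ⟨g1, c1⟩ := key false h1 h2
    obtain ⟨g2, c2⟩ := key true h2 h1
    have b : CO x (o1 + 13 * t + (8 : ℕ)) (o2 + 7 * s + (pos (.hv g1) false false 8).1)
        (pos (.hv g1) false false 8).2 (o2 + 7 * s + (pos (.hv g2) true true 8).1)
        (pos (.hv g2) true true 8).2 := by
      obtain ⟨_, _, _, _, l1⟩ := c1.labl 8 (by omega)
      obtain ⟨_, _, _, _, l2⟩ := c2.labl 8 (by omega)
      rw [tab_pos8] at l1 l2 ⊢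
      rw [tab_pos8]
      have e : o1 + 13 * t + ((8 : ℕ) : ℤ) = (o1 + 13 * t + 7) + 1 := by push_cast; ring
      rw [e] at l1 l2 ⊢
      exact CO.base _ _ (by rw [l1]; simp) (by rw [l2]; simp)
    have := CO_run c1 c2 8 b 5 le_rfl
    refine CO_cast this ?_ ?_ ?_
    · push_cast; ring
    · simp [pos]; ring
    · simp [pos]; ring
  | @step t s1 d1 s2 d2 e1 e2 h1 h2 h3 ih =>
    obtain ⟨κ1, rfl, h, a1⟩ := macPred hY h2
    obtain ⟨κ2, rfl, h', a2⟩ := macPred hY h3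
    have c1 := chain hY (a1 false)
    have c2 := chain hY (a2 true)
    have := CO_run c1 c2 0 (by simpa [pos] using ih) 13 le_rfl
    refine CO_cast this ?_ ?_ ?_
    · push_cast; ring
    · simp [pos]; ring
    · simp [pos]; ring

/-- enclosure with left edge `(s1,d1)` -/
def EnclE (x : Dg) (t s s1 : ℤ) (d1 : Bool) : Prop :=
  ∃ s2 d2 e1 e2, CO x t s1 d1 s2 d2 ∧ s1 < s ∧ s < s2 ∧ (s - s1) % 2 = 0 ∧ (s2 - s) % 2 = 0 ∧
    PredB x t s1 d1 e1 ∧ PredB x t s2 d2 e2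

def Encl (x : Dg) (t s : ℤ) : Prop := ∃ s1 d1, EnclE x t s s1 d1

theorem am_odd (d : Bool) : (((am d).val : ℤ) - 5) % 2 = 1 := by cases d <;> decide

theorem transfer {x : Dg} (hY : YD x) {o1 o2 τ σ : ℤ} (h : Encl (mac x o1 o2) τ σ)
    (i : ℕ) (hi : i < 13) (s' : ℤ) (hs1 : -7 ≤ s') (hs2 : s' < 7) (hp : (s' + i) % 2 = 1) :
    ∃ s1 d1 q h σ1, EnclE x (o1 + 13 * τ + i) (o2 + 7 * σ + s') s1 d1 ∧
      x (o1 + 13 * τ + i) s1 d1 = some (q, h) ∧ (q.2.1.val : ℤ) = i ∧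
      s1 = o2 + 7 * σ1 + q.2.2.val - 5 := by
  obtain ⟨σ1, D1, σ2, D2, e1, e2, h1, h2, h3, h4, h5, h6, h7⟩ := h
  obtain ⟨κ1, rfl, h, a1⟩ := macPred hY h6
  obtain ⟨κ2, rfl, h', a2⟩ := macPred hY h7
  have c1 := chain hY (a1 false)
  have c2 := chain hY (a2 true)
  have hc := CO_run c1 c2 0 (by simpa [pos] using CO_mac hY h1) i (by omega)
  rw [Nat.zero_add] at hc
  obtain ⟨q, hq, q1, q2, q3⟩ := c1.labl i hi
  obtain ⟨q', hq', q1', q2', q3'⟩ := c2.labl i hi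
  have p1 := c1.parity (by simpa [pos] using am_odd _) i (by omega)
  have p2 := c2.parity (by simpa [pos] using am_odd _) i (by omega)
  have r1 := q.2.2.isLt
  have r2 := q'.2.2.isLt
  refine ⟨_, _, q, hq, σ1, ⟨_, _, _, _, hc, ?_, ?_, ?_, ?_, c1.link i hi, c2.link i hi⟩, q3,
    by omega, by omega⟩ <;> omega

/-! noncrossing -/

def key (s : ℤ) (d : Bool) : ℤ := 2 * s + (if d then 0 else 1)

theorem key_inj {s s' : ℤ} {d d' : Bool} (h : key s d = key s' d') : s = s' ∧ d = d' := by
  unfold key at h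
  cases d <;> cases d' <;> simp at h ⊢ <;> omega

theorem PredB_mono {x : Dg} {t s s' : ℤ} {d d' e e' : Bool} (h : PredB x t s d e)
    (h' : PredB x t s' d' e') (hp : (s - s') % 2 = 0)
    (hlt : key (s + sg e) e < key (s' + sg e') e') : key s d < key s' d' := by
  rcases lt_trichotomy s s' with hs | rfl | hs
  · unfold key
    split_ifs <;> omega
  · have he : e = false ∧ e' = true := by
      unfold key sg at hlt
      cases e <;> cases e' <;> simp at hlt ⊢
    obtain ⟨rfl, rfl⟩ := he
    rcases h with h | ⟨h, rfl⟩
    · obtain ⟨_, _, _, _, _, hn⟩ := h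
      exfalso
      rcases h' with ⟨_, _, _, _, h, _⟩ | ⟨⟨_, _, _, _, _, h⟩, _⟩ <;> simp [h] at hn
    · rcases h' with h' | ⟨h', rfl⟩
      · obtain ⟨_, _, _, _, _, hn⟩ := h'
        obtain ⟨_, _, _, _, _, h⟩ := h
        simp [h] at hn
      · unfold key; simp
  · exfalso
    unfold key sg at hlt
    cases e <;> cases e' <;> simp at hlt <;> omega

theorem CO_empty {x : Dg} (hY : YD x) {t s1 s2 : ℤ} {d1 d2 : Bool} (h : CO x t s1 d1 s2 d2) :
    ∀ s d, x t s d ≠ none → (s - s1) % 2 = 0 → (s2 - s1) % 2 = 0 ∧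
      ¬ (key s1 d1 < key s d ∧ key s d < key s2 d2) := by
  induction h with
  | base t s h1 h2 =>
    intro s' d hx hp
    unfold key
    simp only [sg] at *
    refine ⟨by simp, ?_⟩
    cases d <;> simp <;> simp at hp <;> omega
  | @step t s1 d1 s2 d2 e1 e2 h1 h2 h3 ih =>
    intro s d hx hp
    have hx' : x (t + 1) (s - sg d + sg d) d ≠ none := by simpa using hx
    obtain ⟨d', hd'⟩ := hY t (s - sg d) d hx'
    have sge : ∀ e, sg e = 1 ∨ sg e = -1 := by intro e; cases e <;> simp [sg]
    have g1 := sge e1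
    have g2 := sge e2
    have g3 := sge d
    have hl : x t (s - sg d) d' ≠ none := by
      rcases hd' with ⟨_, _, h, _⟩ | ⟨⟨_, _, _, h, _⟩, _⟩ <;> simp [h]
    have := ih (s - sg d) d' hl (by omega)
    refine ⟨by omega, ?_⟩
    rintro ⟨k1, k2⟩
    apply this.2
    constructor
    · exact PredB_mono h2 hd' (by omega) (by simpa using k1)
    · exact PredB_mono hd' h3 (by omega) (by simpa using k2)

theorem EnclE_uniq {x : Dg} (hY : YD x) {t s s1 s1' : ℤ} {d1 d1' : Bool}
    (h : EnclE x t s s1 d1) (h' : EnclE x t s s1' d1') : s1 = s1' ∧ d1 = d1' := by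
  obtain ⟨s2, d2, e1, e2, h1, h2, h3, h4, h5, h6, h7⟩ := h
  obtain ⟨s2', d2', e1', e2', h1', h2', h3', h4', h5', h6', h7'⟩ := h'
  have lv : ∀ {s d e}, PredB x t s d e → x t s d ≠ none := by
    intro s d e h
    rcases h with ⟨_, _, h, _⟩ | ⟨⟨_, _, _, h, _⟩, _⟩ <;> simp [h]
  have a1 := (CO_empty hY h1 s1' d1' (lv h6') (by omega)).2
  have a2 := (CO_empty hY h1' s1 d1 (lv h6) (by omega)).2
  apply key_inj
  have b1 : key s1' d1' < key s2 d2 := by unfold key; split_ifs <;> omega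
  have b2 : key s1 d1 < key s2' d2' := by unfold key; split_ifs <;> omega
  by_contra hne
  rcases lt_or_gt_of_ne hne with hh | hh
  · exact a1 ⟨hh, b1⟩
  · exact a2 ⟨hh, b2⟩

end SSCA

namespace SSCA

def Surv (x : Dg) : ℕ → ℤ → ℤ → Bool → Prop
  | 0, t, s, d => x t s d ≠ none
  | n + 1, t, s, d => ∃ e, Anc x t s d e ∧ Surv x n (t + 1) (s + sg e) e

theorem Anc_live {x : Dg} {t s : ℤ} {d e : Bool} (h : Anc x t s d e) : x t s d ≠ none := by
  rcases h with ⟨_, _, h, _⟩ | ⟨_, _, _, h, _⟩ <;> simp [h]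

theorem Surv_live {x : Dg} {n : ℕ} {t s : ℤ} {d : Bool} (h : Surv x n t s d) :
    x t s d ≠ none := by
  cases n with
  | zero => exact h
  | succ n => obtain ⟨e, h, -⟩ := h; exact Anc_live h

theorem Surv_mono {x : Dg} : ∀ {n m : ℕ} {t s : ℤ} {d : Bool}, m ≤ n → Surv x n t s d →
    Surv x m t s d := by
  intro n
  induction n with
  | zero => intro m t s d hm h; have : m = 0 := by omega
            subst this; exact h
  | succ n ih =>
    intro m t s d hm h
    cases m with
    | zero => exact Surv_live h
    | succ m =>
      obtain ⟨e, h1, h2⟩ := h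
      exact ⟨e, h1, ih (by omega) h2⟩

theorem Anc_lab {x : Dg} {t s : ℤ} {d e : Bool} {q : P} {h : SSCA.D} (ha : Anc x t s d e)
    (hx : x t s d = some (q, h)) : okOut q e ∧
    ((isM q = none ∧ ∃ h', x (t + 1) (s + sg e) e = some (adv q e, h')) ∨
     (∃ (D : Bool) (c : Bool → SSCA.D) (κ : Kind) (h' : SSCA.D), q = Lm D ∧ (∀ f, x t s f = some (Lm D, c f)) ∧ disp D (c (!D)).1 = some κ ∧
       x (t + 1) (s + sg e) e = some ((κ, 1, mvA (am D) e), h'))) := by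
  rcases ha with ⟨p, k, h1, h2, h3, h4⟩ | ⟨p, c, o, h1, h2, h3⟩
  · rw [hx] at h1
    simp only [Option.some.injEq, Prod.mk.injEq] at h1
    rw [h1.1]
    exact ⟨solo_okOut h2, Or.inl ⟨solo_isM h2, _, h3⟩⟩
  · have h1' := h1 d
    rw [hx] at h1'
    simp only [Option.some.injEq, Prod.mk.injEq] at h1'
    rw [h1'.1]
    obtain ⟨g, κ, o', k1, k2, k3, k4⟩ := gate_some h2
    refine ⟨cross_okOut k1, ?_⟩
    rw [k4] at h3
    rcases hm : isM p with _ | D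
    · left
      refine ⟨rfl, o' e, ?_⟩
      rw [h3]; simp [outLab, hm]
    · right
      have := isM_some hm
      subst this
      refine ⟨D, c, κ, o' e, rfl, h1, ?_, ?_⟩
      · simpa [kd, hm] using k2
      · rw [h3]; simp [outLab, hm]

theorem tab_adv0 : ∀ (p : P) (e : Bool), okOut p e → isM p = none → p.2.1.val = 12 →
    ∃ d, adv p e = Lm d := by
  intro p e h1 h2 h3
  obtain ⟨d, h, -⟩ := (tab_adv p e h1 h2).2.2 h3
  exact ⟨d, h⟩

theorem fwd_walk {x : Dg} {T S : ℤ} {n : ℕ} : ∀ (k : ℕ) (q : P) (d : Bool) (h : D),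
    1 ≤ q.2.1.val → q.2.1.val + k = 12 → E x T S q d h →
    Surv x (k + 1 + n) (T + q.2.1.val) (S + q.2.2.val - 5) d →
    ∃ d'' e h' h'', x (T + 13) (S + 7 * sg d'' + (am d'').val - 5) e = some (Lm d'', h') ∧
      Surv x n (T + 13) (S + 7 * sg d'' + (am d'').val - 5) e ∧
      E x T S (q.1, 12, mvA (fin9 d'') (!e)) d'' h'' := by
  intro k
  induction k with
  | zero =>
    intro q d h hq1 hqk hE hS
    rw [show 0 + 1 + n = n + 1 by omega] at hS
    obtain ⟨e, ha, hS⟩ := hS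
    obtain ⟨hok, ⟨hm, h', hx'⟩ | ⟨D, c, κ, h', rfl, -⟩⟩ := Anc_lab ha hE
    · obtain ⟨d'', hd⟩ := tab_adv0 q e hok hm (by omega)
      obtain ⟨g1, g2, g3, g4⟩ := tab_j0 q e d'' hok hm hd
      have hsl := tab_slot q e d'' hok hm hd
      have e1 : T + (q.2.1.val : ℤ) + 1 = T + 13 := by omega
      have e2 : S + (q.2.2.val : ℤ) - 5 + sg e = S + 7 * sg d'' + (am d'').val - 5 := by omega
      rw [e1, e2] at hx' hS
      rw [hd] at hx'
      refine ⟨d'', e, h', h, hx', hS, ?_⟩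
      have hd' : d = d'' := by
        rw [← hsl]
        rcases ha with ⟨p, k, h1, h2, h3, h4⟩ | ⟨p, c, o, h1, h2, h3⟩
        · rw [hE] at h1
          simp only [Option.some.injEq, Prod.mk.injEq] at h1
          rw [h1.1]
          simp [slotOf, h2]
        · have h1' := h1 d
          rw [hE] at h1'
          simp only [Option.some.injEq, Prod.mk.injEq] at h1'
          obtain ⟨g, κ, o', k1, -⟩ := gate_some h2
          exact absurd k1 (tab_c12 p (by rw [← h1'.1]; exact g1) g)
      rw [← hd', hd', ← g1, ← g2, ← hd']
      exact hE
    · simp [Lm] at hq1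
  | succ k ih =>
    intro q d h hq1 hqk hE hS
    rw [show k + 1 + 1 + n = (k + 1 + n) + 1 by omega] at hS
    obtain ⟨e, ha, hS⟩ := hS
    obtain ⟨hok, ⟨hm, h', hx'⟩ | ⟨D, c, κ, h', rfl, -⟩⟩ := Anc_lab ha hE
    · obtain ⟨g1, g2, g3⟩ := tab_adv q e hok hm
      obtain ⟨g4, g5⟩ := g2 (by omega)
      have hj : (q.2.1 + 1).val = q.2.1.val + 1 := by
        rw [Fin.val_add_one_of_lt]
        rw [Fin.lt_def]; simp; omega
      have := ih (adv q e) e h' (by rw [g4]; simp only; omega) (by rw [g4]; simp only; omega) ?_ ?_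
      · rw [g4] at this
        exact this
      · unfold E
        rw [← hx', g4]
        simp only
        rw [hj]
        congr 1
        · push_cast; ring
        · omega
      · rw [g4]
        simp only
        rw [hj]
        convert hS using 1
        · push_cast; ring
        · omega
    · simp [Lm] at hq1

theorem disp_solo {D D' d : Bool} {π : P} (h : disp D π = some (.solo D' d)) : D' = D := by
  unfold disp at h
  split at h
  · split_ifs at h
    simp at h
    exact h.1.symm
  · simp at h
  · simp at h

theorem isM_none_Lm {d : Bool} (h : isM (Lm d) = none) : False := by
  rw [isM_Lm] at h; simp at h

theorem surv_m {x : Dg} (hY : YD x) {o1 o2 : ℤ} : ∀ (k : ℕ) (τ σ : ℤ) (D e : Bool) (h : SSCA.D),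
    x (o1 + 13 * τ) (o2 + 7 * σ + (am D).val - 5) e = some (Lm D, h) →
    Surv x (13 * k + 1) (o1 + 13 * τ) (o2 + 7 * σ + (am D).val - 5) e →
    Surv (mac x o1 o2) k τ σ D := by
  intro k
  induction k with
  | zero =>
    intro τ σ D e h hx hS
    obtain ⟨e', ha, -⟩ := hS
    obtain ⟨-, ⟨hm, -⟩ | ⟨D', c, κ, h', h1, h2, -⟩⟩ := Anc_lab ha hx
    · exact (isM_none_Lm hm).elim
    · have hDD : D = D' := by cases D <;> cases D' <;> simp_all [Lm, am]
      subst hDD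
      have : MS x (o1 + 13 * τ) (o2 + 7 * σ) D c := fun f => Lm_E.2 (h2 f)
      show mac x o1 o2 τ σ D ≠ none
      rw [mac_of this]; simp
  | succ k ih =>
    intro τ σ D e h hx hS
    rw [show 13 * (k + 1) + 1 = (11 + 1 + (13 * k + 1)) + 1 by ring] at hS
    obtain ⟨e', ha, hS⟩ := hS
    obtain ⟨-, ⟨hm, -⟩ | ⟨D', c, κ, h', h1, h2, h3, h4⟩⟩ := Anc_lab ha hx
    · exact (isM_none_Lm hm).elim
    have hDD : D = D' := by cases D <;> cases D' <;> simp_all [Lm, am]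
    subst hDD
    have ham := am_mv D e'
    have e2 : o2 + 7 * σ + ((am D).val : ℤ) - 5 + sg e' =
      o2 + 7 * σ + ((mvA (am D) e').val : ℤ) - 5 := by omega
    rw [e2] at hS h4
    obtain ⟨d'', e, h5, h6, k1, k2, k3⟩ := fwd_walk (n := 13 * k + 1) (T := o1 + 13 * τ)
      (S := o2 + 7 * σ) 11 (κ, 1, mvA (am D) e') e' h' le_rfl rfl (by simpa [E] using h4)
      (by simpa using hS)
    have e3 : o1 + 13 * τ + 13 = o1 + 13 * (τ + 1) := by ring
    have e4 : o2 + 7 * σ + 7 * sg d'' + ((am d'').val : ℤ) - 5 =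
      o2 + 7 * (σ + sg d'') + (am d'').val - 5 := by ring
    rw [e3, e4] at k1 k2
    have k4 := ih _ _ _ _ _ k1 k2
    refine ⟨d'', ?_, k4⟩
    obtain ⟨κ0, ⟨hh, a1⟩, ⟨a2, a3⟩ | ⟨_, a3⟩⟩ := macBack hY (Surv_live k4)
    · left
      have b1 := (a1 e).2.1
      have b0 := (a1 e).1
      have b3 : (c0 κ0 d'' e).2 = d'' := by
        have : ∀ κ d e, okOut (c0 κ d e).1 e → (c0 κ d e).2 = d := by decide +kernel
        exact this _ _ _ b0
      rw [b3] at b1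
      have := (E_inj k3 b1 rfl rfl).1
      have hk : κ = κ0 := congrArg Prod.fst this
      subst hk
      rw [a2] at h3
      have := disp_solo h3
      rw [this] at a3
      exact a3
    · right; exact a3

theorem surv_mac {x : Dg} (hY : YD x) {o1 o2 τ σ : ℤ} {k : ℕ} {q : P} {d : Bool} {h : D}
    (hE : E x (o1 + 13 * τ) (o2 + 7 * σ) q d h)
    (hS : Surv x (13 * (k + 1) + 1) (o1 + 13 * τ + q.2.1.val) (o2 + 7 * σ + q.2.2.val - 5) d) :
    ∃ D, Surv (mac x o1 o2) (k + 1) τ σ D := by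
  by_cases hj : q.2.1.val = 0
  · obtain ⟨e, ha, -⟩ := id hS
    obtain ⟨hok, ⟨hm, h', hx'⟩ | ⟨D, c, κ, h', rfl, -⟩⟩ := Anc_lab ha hE
    · exact absurd hj (tab_adv q e hok hm).1
    · exact ⟨D, surv_m hY (k + 1) τ σ D d h (Lm_E.1 hE) (by simpa [Lm] using hS)⟩
  · have hlt := q.2.1.isLt
    obtain ⟨d'', e, h5, h6, k1, k2, k3⟩ := fwd_walk (n := 13 * k + 1) (12 - q.2.1.val) q d h
      (by omega) (by omega) hE (Surv_mono (by omega) hS)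
    have e3 : o1 + 13 * τ + 13 = o1 + 13 * (τ + 1) := by ring
    have e4 : o2 + 7 * σ + 7 * sg d'' + ((am d'').val : ℤ) - 5 =
      o2 + 7 * (σ + sg d'') + (am d'').val - 5 := by ring
    rw [e3, e4] at k1 k2
    have k4 := surv_m hY k _ _ _ _ _ k1 k2
    obtain ⟨D, hD⟩ := mac_YD hY o1 o2 τ σ d'' (Surv_live k4)
    refine ⟨D, d'', ?_, k4⟩
    rcases hD with h | ⟨h, -⟩
    · exact Or.inl h
    · exact Or.inr h

theorem tab_pos1 : ∀ κ d, okOut (c0 κ d true).1 true → okOut (c0 κ d false).1 false →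
    pos κ d true 1 = (((am (Dof κ d)).val : ℤ) - 5 + sg false, false) ∧
    pos κ d true 2 = (((am (Dof κ d)).val : ℤ) - 5 - 2, false) ∧
    pos κ d false 1 = (((am (Dof κ d)).val : ℤ) - 5 + sg true, true) ∧
    pos κ d false 2 = (((am (Dof κ d)).val : ℤ) - 5 + 2, true) := by
  decide +kernel

theorem encl_of_surv {x : Dg} (hY : YD x) {T S : ℤ} {q : P} {d : Bool} {h : D}
    (hE : E x T S q d h) (hS : Surv x 14 (T + q.2.1.val) (S + q.2.2.val - 5) d) :
    ∃ w : ℤ, -5 ≤ w ∧ w ≤ 5 ∧ Encl x (T + 2) (S + w) := by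
  obtain ⟨D, d'', ha, hl⟩ := surv_mac hY (o1 := T) (o2 := S) (τ := 0) (σ := 0) (k := 0)
    (by simpa using hE) (by simpa using hS)
  obtain ⟨κ, ⟨h, k1⟩, -⟩ := macBack hY (Surv_live hl)
  have c1 := chain hY (k1 true)
  have c2 := chain hY (k1 false)
  simp only [mul_zero, add_zero] at c1 c2
  obtain ⟨p1, p2, p3, p4⟩ := tab_pos1 κ d'' (k1 true).1 (k1 false).1
  have b : CO x (T + (1 : ℕ)) (S + (pos κ d'' true 1).1) (pos κ d'' true 1).2
      (S + (pos κ d'' false 1).1) (pos κ d'' false 1).2 := by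
    obtain ⟨_, _, _, _, l1⟩ := c1.labl 1 (by omega)
    obtain ⟨_, _, _, _, l2⟩ := c2.labl 1 (by omega)
    rw [p1] at l1 ⊢
    rw [p3] at l2 ⊢
    simp only [← add_assoc, Nat.cast_one] at l1 l2 ⊢
    exact CO.base _ _ (by rw [l1]; simp) (by rw [l2]; simp)
  have c := CO_run c1 c2 1 b 1 (by omega)
  have r := (am (Dof κ d'')).isLt
  have l1 := c1.link 2 (by omega)
  have l2 := c2.link 2 (by omega)
  simp only [Nat.reduceAdd] at c l1 l2
  refine ⟨(am (Dof κ d'')).val - 5, by omega, by omega, _, _, _, _, _, _, c, ?_, ?_, ?_, ?_, l1, l2⟩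
  all_goals simp only [p2, p4]
  all_goals omega

/-! the relation R -/

def R : ℕ → Dg → ℤ × ℤ → ℤ × ℤ → Prop
  | 0, x, v, w => Encl x w.1 w.2 ∧ |w.1 - v.1| ≤ 40 ∧ |w.2 - v.2| ≤ 40
  | n + 1, x, v, w => ∃ (o1 o2 : ℤ) (V W : ℤ × ℤ) (j i : ℕ) (s s' : ℤ),
      0 ≤ o1 ∧ o1 < 13 ∧ 0 ≤ o2 ∧ o2 < 7 ∧ R n (mac x o1 o2) V W ∧ j < 13 ∧ i < 13 ∧
      -5 ≤ s ∧ s ≤ 5 ∧ (s + j) % 2 = 1 ∧ -7 ≤ s' ∧ s' < 7 ∧ (s' + i) % 2 = 1 ∧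
      v = (o1 + 13 * V.1 + j, o2 + 7 * V.2 + s) ∧ w = (o1 + 13 * W.1 + i, o2 + 7 * W.2 + s')

theorem R_encl : ∀ (n : ℕ) (x : Dg), YD x → ∀ v w, R n x v w → Encl x w.1 w.2 := by
  intro n
  induction n with
  | zero => intro x _ v w h; exact h.1
  | succ n ih =>
    rintro x hY v w ⟨o1, o2, V, W, j, i, s, s', a1, a2, a3, a4, a5, a6, a7, a8, a9, a10, a11,
      a12, a13, rfl, rfl⟩
    obtain ⟨s1, d1, q, h, σ1, h1, -⟩ := transfer hY (ih _ (mac_YD hY o1 o2) _ _ a5) i a7 s' a11 a12 a13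
    exact ⟨s1, d1, h1⟩

def bb : ℕ → ℤ
  | 0 => 40
  | n + 1 => 7 * bb n + 12

theorem bb_nonneg (n : ℕ) : 0 ≤ bb n := by
  induction n with
  | zero => simp [bb]
  | succ n ih => simp only [bb]; omega

theorem R_dist : ∀ (n : ℕ) (x : Dg) (v w), R n x v w →
    |w.1 - v.1| ≤ 42 * 13 ^ n - 2 ∧ |w.2 - v.2| ≤ bb n := by
  intro n
  induction n with
  | zero => intro x v w h; exact ⟨by simpa using h.2.1, by simpa [bb] using h.2.2⟩
  | succ n ih =>
    rintro x v w ⟨o1, o2, V, W, j, i, s, s', a1, a2, a3, a4, a5, a6, a7, a8, a9, a10, a11,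
      a12, a13, rfl, rfl⟩
    obtain ⟨h1, h2⟩ := ih _ _ _ a5
    rw [abs_le] at *
    rw [abs_le] at *
    simp only [bb, pow_succ] at *
    constructor <;> constructor <;> omega

def NN : ℕ → ℕ
  | 0 => 14
  | n + 1 => 13 * NN n + 1

theorem NN_pos (n : ℕ) : 1 ≤ NN n := by cases n <;> simp [NN]

theorem tab_par : ∀ (p : P) (e : Bool), okOut p e → (p.2.2.val + p.2.1.val) % 2 = 0 := by
  decide +kernel

theorem R_many : ∀ (n : ℕ) (x : Dg), YD x → ∀ t s d, Surv x (NN n) t s d →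
    ∃ W : Finset (ℤ × ℤ), 91 ^ n ≤ W.card ∧ ∀ w ∈ W, R n x (t, s) w := by
  intro n
  induction n with
  | zero =>
    intro x hY t s d hS
    obtain ⟨⟨q, h⟩, hx⟩ := Option.ne_none_iff_exists'.1 (Surv_live hS)
    have hE : E x (t - q.2.1.val) (s - q.2.2.val + 5) q d h := by
      unfold E; rw [← hx]; congr 1 <;> ring
    have hS' : Surv x 14 t s d := hS
    obtain ⟨w, h1, h2, h3⟩ := encl_of_surv hY hE (by convert hS' using 1 <;> ring)
    refine ⟨{(t - q.2.1.val + 2, s - q.2.2.val + 5 + w)}, by simp, ?_⟩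
    intro w' hw'
    rw [Finset.mem_singleton] at hw'
    subst hw'
    have r1 := q.2.2.isLt
    have r2 := q.2.1.isLt
    refine ⟨h3, ?_, ?_⟩ <;> rw [abs_le] <;> constructor <;> simp only <;> omega
  | succ n ih =>
    intro x hY t s d hS
    obtain ⟨⟨q, h⟩, hx⟩ := Option.ne_none_iff_exists'.1 (Surv_live hS)
    set T : ℤ := t - q.2.1.val with hT
    set S : ℤ := s - q.2.2.val + 5 with hSS
    have eT : T % 13 + 13 * (T / 13) = T := Int.emod_add_mul_ediv T 13
    have eS : S % 7 + 7 * (S / 7) = S := Int.emod_add_mul_ediv S 7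
    have hE : E x (T % 13 + 13 * (T / 13)) (S % 7 + 7 * (S / 7)) q d h := by
      unfold E; rw [eT, eS, ← hx]; congr 1 <;> simp only [hT, hSS] <;> ring
    have hpar : (q.2.2.val + q.2.1.val) % 2 = 0 := by
      obtain ⟨e, ha, -⟩ := id hS
      exact tab_par q e (Anc_lab ha hx).1
    obtain ⟨k, hk⟩ : ∃ k, NN n = k + 1 := ⟨NN n - 1, by have := NN_pos n; omega⟩
    obtain ⟨D, hD⟩ := surv_mac hY (k := k) hE (by
      rw [eT, eS]
      simp only [NN, hk] at hS
      convert hS using 1 <;> simp only [hT, hSS] <;> ring)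
    rw [← hk] at hD
    obtain ⟨W, hW1, hW2⟩ := ih _ (mac_YD hY _ _) _ _ _ hD
    set f : (ℤ × ℤ) × ℕ × ℕ → ℤ × ℤ := fun z =>
      (T % 13 + 13 * z.1.1 + z.2.1, S % 7 + 7 * z.1.2 + (2 * z.2.2 - 7 + (z.2.1 % 2 : ℕ))) with hf
    refine ⟨(W ×ˢ Finset.range 13 ×ˢ Finset.range 7).image f, ?_, ?_⟩
    · rw [Finset.card_image_of_injOn]
      · simp only [Finset.card_product, Finset.card_range]
        rw [pow_succ]
        omega
      · rintro ⟨⟨a, b⟩, i, k⟩ h1 ⟨⟨a', b'⟩, i', k'⟩ h2 heq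
        simp only [Finset.coe_product, Set.mem_prod, Finset.mem_coe, Finset.mem_range] at h1 h2
        simp only [hf, Prod.mk.injEq] at heq
        obtain ⟨-, h11, h12⟩ := h1
        obtain ⟨-, h21, h22⟩ := h2
        have hi : i = i' := by omega
        subst hi
        have ha : a = a' := by omega
        have hb : b = b' := by omega
        have hk : k = k' := by omega
        rw [ha, hb, hk]
    · intro w hw
      rw [Finset.mem_image] at hw
      obtain ⟨⟨⟨a, b⟩, i, k⟩, h1, rfl⟩ := hw
      simp only [Finset.mem_product, Finset.mem_range] at h1
      obtain ⟨h11, h12, h13⟩ := h1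
      have r1 := q.2.2.isLt
      have r2 := q.2.1.isLt
      refine ⟨T % 13, S % 7, (T / 13, S / 7), (a, b), q.2.1.val, i, q.2.2.val - 5,
        2 * k - 7 + (i % 2 : ℕ), ?_, ?_, ?_, ?_, hW2 _ h11, r2, h12, ?_, ?_, ?_, ?_, ?_, ?_, ?_, rfl⟩
      any_goals omega
      simp only [Prod.mk.injEq]
      constructor <;> omega

theorem R_few : ∀ (n : ℕ) (x : Dg), YD x → ∀ (t : ℤ) (w : ℤ × ℤ) (V : Finset ℤ),
    (∀ s ∈ V, R n x (t, s) w) → V.card ≤ 81 * 6 ^ n := by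
  intro n
  induction n with
  | zero =>
    intro x hY t w V hV
    have : V ⊆ Finset.Icc (w.2 - 40) (w.2 + 40) := by
      intro s hs
      have := (hV s hs).2.2
      rw [abs_le] at this
      rw [Finset.mem_Icc]
      simp only at this
      omega
    have := Finset.card_le_card this
    rw [Int.card_Icc] at this
    omega
  | succ n ih =>
    intro x hY t w V hV
    rcases V.eq_empty_or_nonempty with rfl | ⟨s0, hs0⟩
    · simp
    -- origins
    have key : ∀ s ∈ V, ∀ s' ∈ V, True := fun _ _ _ _ => trivial
    obtain ⟨o1, o2, V0, W0, j, i, u, u', a1, a2, a3, a4, a5, a6, a7, a8, a9, a10, a11,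
      a12, a13, a14, a15⟩ := hV s0 hs0
    obtain ⟨s1, d1, q, h, σ1, k1, k2, k3, k4⟩ := transfer hY
      (R_encl _ _ (mac_YD hY o1 o2) _ _ a5) i a7 u' a11 a12 a13
    have hall : ∀ s ∈ V, ∃ σ r : ℤ, R n (mac x o1 o2) (V0.1, σ) W0 ∧ s = o2 + 7 * σ + r ∧
        -5 ≤ r ∧ r ≤ 5 ∧ (r + j) % 2 = 1 := by
      intro s hs
      obtain ⟨o1', o2', V0', W0', j', i', r, r', b1, b2, b3, b4, b5, b6, b7, b8, b9, b10, b11,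
        b12, b13, b14, b15⟩ := hV s hs
      obtain ⟨s1', d1', q', h', σ1', k1', k2', k3', k4'⟩ := transfer hY
        (R_encl _ _ (mac_YD hY o1' o2') _ _ b5) i' b7 r' b11 b12 b13
      have hw := a15.symm.trans b15
      simp only [Prod.mk.injEq] at hw a14 b14
      rw [← hw.1, ← hw.2] at k1'
      obtain ⟨m1, m2⟩ := EnclE_uniq hY k1 k1'
      rw [← hw.1, ← m1, ← m2, k2] at k2'
      simp only [Option.some.injEq, Prod.mk.injEq] at k2'
      rw [← k2'.1] at k3' k4'
      have hi : i = i' := by omega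
      have ho1 : o1 = o1' := by omega
      have ho2 : o2 = o2' := by omega
      subst ho1 ho2
      have hj : j = j' := by omega
      have hW : W0' = W0 := by
        apply Prod.ext <;> omega
      subst hW
      refine ⟨V0'.2, r, ?_, b14.2, b8, b9, by omega⟩
      have : V0.1 = V0'.1 := by omega
      rw [this]
      exact b5
    choose! σ r g1 g2 g3 g4 g5 using hall
    have hcard : V.card ≤ 6 * (V.image σ).card := by
      apply Finset.card_le_mul_card_image
      intro b hb
      have hsub : (V.filter (fun s => σ s = b)) ⊆
          (Finset.range 6).image (fun k : ℕ => o2 + 7 * b + (2 * (k : ℤ) - 5 + (j % 2 : ℕ))) := by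
        intro s hs
        rw [Finset.mem_filter] at hs
        rw [Finset.mem_image]
        have e2 := g2 s hs.1
        have e3 := g3 s hs.1
        have e4 := g4 s hs.1
        have e5 := g5 s hs.1
        rw [hs.2] at e2
        refine ⟨((r s + 5) / 2).toNat, ?_, ?_⟩
        · rw [Finset.mem_range]; omega
        · omega
      calc _ ≤ _ := Finset.card_le_card hsub
        _ ≤ 6 := by
          refine Finset.card_image_le.trans ?_
          simp
    have := ih _ (mac_YD hY o1 o2) V0.1 W0 (V.image σ) (by
      intro s hs
      rw [Finset.mem_image] at hs
      obtain ⟨s, hs, rfl⟩ := hs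
      exact g1 s hs)
    rw [pow_succ]
    omega

/-- density bound -/
theorem density {x : Dg} (hY : YD x) (n : ℕ) (t lo : ℤ) (ℓ : ℕ) (V : Finset ℤ)
    (hV : ∀ s ∈ V, lo ≤ s ∧ s ≤ lo + ℓ ∧ ∃ d, Surv x (NN n) t s d) :
    (V.card : ℤ) * 91 ^ n ≤ 6804 * 78 ^ n * (ℓ + 2 * bb n + 1) := by
  classical
  have hb := bb_nonneg n
  have h13 : (1 : ℤ) ≤ 13 ^ n := one_le_pow₀ (by norm_num)
  set Wd : Finset (ℤ × ℤ) := Finset.Icc (t - (42 * 13 ^ n - 2)) (t + (42 * 13 ^ n - 2)) ×ˢ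
    Finset.Icc (lo - bb n) (lo + ℓ + bb n) with hWd
  have h1 : V.card * 91 ^ n ≤ Wd.card * (81 * 6 ^ n) := by
    apply Finset.card_mul_le_card_mul (fun s w => R n x (t, s) w)
    · intro s hs
      obtain ⟨b1, b2, d, b3⟩ := hV s hs
      obtain ⟨W, hW1, hW2⟩ := R_many n x hY t s d b3
      refine hW1.trans (Finset.card_le_card ?_)
      intro w hw
      rw [Finset.mem_bipartiteAbove]
      refine ⟨?_, hW2 w hw⟩
      obtain ⟨d1, d2⟩ := R_dist n x _ _ (hW2 w hw)
      rw [abs_le] at d1 d2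
      simp only at d1 d2
      rw [hWd, Finset.mem_product, Finset.mem_Icc, Finset.mem_Icc]
      omega
    · intro w hw
      apply R_few n x hY t w
      intro s hs
      rw [Finset.mem_bipartiteBelow] at hs
      exact hs.2
  have h2 : (Wd.card : ℤ) ≤ (84 * 13 ^ n) * (ℓ + 2 * bb n + 1) := by
    rw [hWd, Finset.card_product, Int.card_Icc, Int.card_Icc]
    push_cast
    rw [Int.toNat_of_nonneg (by omega), Int.toNat_of_nonneg (by omega)]
    apply mul_le_mul <;> omega
  have h3 : (V.card : ℤ) * 91 ^ n ≤ (Wd.card : ℤ) * (81 * 6 ^ n) := by exact_mod_cast h1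
  calc _ ≤ _ := h3
    _ ≤ ((84 * 13 ^ n) * (ℓ + 2 * bb n + 1)) * (81 * 6 ^ n) := by
      apply mul_le_mul_of_nonneg_right h2; positivity
    _ = 6804 * 78 ^ n * (ℓ + 2 * bb n + 1) := by
      rw [show (78 : ℤ) = 13 * 6 by norm_num, mul_pow]; ring

end SSCA

namespace SSCA

def Tr (x : Dg) : ℕ → ℤ → ℤ → Bool → ℤ → Bool → Prop
  | 0, _, s, d, s', d' => s = s' ∧ d = d'
  | n + 1, t, s, d, s', d' => ∃ s1 d1, Tr x n t s d s1 d1 ∧ PredB x (t + n) s1 d1 d' ∧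
      s' = s1 + sg d'

theorem PredB_live {x : Dg} {t s : ℤ} {d e : Bool} (h : PredB x t s d e) : x t s d ≠ none := by
  rcases h with ⟨_, _, h, _⟩ | ⟨⟨_, _, _, h, _⟩, _⟩ <;> simp [h]

theorem PredB_Anc {x : Dg} {t s : ℤ} {d e : Bool} (h : PredB x t s d e) : Anc x t s d e := by
  rcases h with h | ⟨h, -⟩
  · exact Or.inl h
  · exact Or.inr h

theorem Tr_ex {x : Dg} (hY : YD x) : ∀ (n : ℕ) (t s' : ℤ) (d' : Bool), x (t + n) s' d' ≠ none →
    ∃ s d, Tr x n t s d s' d' := by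
  intro n
  induction n with
  | zero => intro t s' d' _; exact ⟨s', d', rfl, rfl⟩
  | succ n ih =>
    intro t s' d' h
    obtain ⟨d1, h1⟩ := hY (t + n) (s' - sg d') d' (by
      convert h using 2 <;> [(push_cast; ring_nf); ring_nf])
    obtain ⟨s, d, h2⟩ := ih t _ _ (PredB_live h1)
    exact ⟨s, d, _, _, h2, h1, by ring⟩

theorem Tr_surv {x : Dg} : ∀ (n m : ℕ) (t s s' : ℤ) (d d' : Bool), Tr x n t s d s' d' →
    Surv x m (t + n) s' d' → Surv x (n + m) t s d := by
  intro n
  induction n with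
  | zero =>
    rintro m t s s' d d' ⟨rfl, rfl⟩ h2
    simpa using h2
  | succ n ih =>
    rintro m t s s' d d' ⟨s1, d1, h1, h2, rfl⟩ h3
    have := ih (m + 1) t s s1 d d1 h1 ⟨d', PredB_Anc h2, by
      convert h3 using 1; push_cast; ring⟩
    rw [show n + 1 + m = n + (m + 1) by ring]
    exact this

theorem sg_abs (d : Bool) : sg d ≤ 1 ∧ -1 ≤ sg d := by cases d <;> simp [sg]

theorem Tr_split {x : Dg} (n : ℕ) : ∀ (m : ℕ) (t s s' : ℤ) (d d' : Bool), Tr x (n + m) t s d s' d' →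
    ∃ s1 d1, Tr x n t s d s1 d1 ∧ |s' - s1| ≤ m := by
  intro m
  induction m with
  | zero => intro t s s' d d' h; exact ⟨s', d', h, by simp⟩
  | succ m ih =>
    rintro t s s' d d' ⟨s1, d1, h1, h2, rfl⟩
    obtain ⟨s2, d2, h3, h4⟩ := ih _ _ _ _ _ h1
    refine ⟨s2, d2, h3, ?_⟩
    have := sg_abs d'
    rw [abs_le] at *
    push_cast
    omega

theorem Tr_speed {x : Dg} (n : ℕ) (t s s' : ℤ) (d d' : Bool) (h : Tr x n t s d s' d') :
    |s' - s| ≤ n := by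
  obtain ⟨s1, d1, ⟨rfl, rfl⟩, h2⟩ := Tr_split 0 n t s s' d d' (by simpa using h)
  exact h2

theorem PredB_fun {x : Dg} {t s : ℤ} {d e e' : Bool} (h : PredB x t s d e)
    (h' : PredB x t s d e') : e = e' := by
  rcases lt_trichotomy (key (s + sg e) e) (key (s + sg e') e') with hl | hl | hl
  · exact absurd (PredB_mono h h' (by simp) hl) (lt_irrefl _)
  · exact (key_inj hl).2
  · exact absurd (PredB_mono h' h (by simp) hl) (lt_irrefl _)

theorem Tr_fun {x : Dg} : ∀ (n : ℕ) (t s s1 s2 : ℤ) (d d1 d2 : Bool), Tr x n t s d s1 d1 →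
    Tr x n t s d s2 d2 → s1 = s2 ∧ d1 = d2 := by
  intro n
  induction n with
  | zero => rintro t s s1 s2 d d1 d2 ⟨rfl, rfl⟩ ⟨rfl, rfl⟩; exact ⟨rfl, rfl⟩
  | succ n ih =>
    rintro t s s1 s2 d d1 d2 ⟨u1, f1, h1, h2, rfl⟩ ⟨u2, f2, k1, k2, rfl⟩
    obtain ⟨rfl, rfl⟩ := ih _ _ _ _ _ _ _ h1 k1
    obtain rfl := PredB_fun h2 k2
    exact ⟨rfl, rfl⟩

theorem growth (A : ℕ) : ∃ n : ℕ, (A : ℤ) * 78 ^ n + 1 ≤ 91 ^ n := by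
  obtain ⟨n, hn⟩ := pow_unbounded_of_one_lt (A : ℚ) (show (1 : ℚ) < 91 / 78 by norm_num)
  refine ⟨n, ?_⟩
  rw [div_pow, lt_div_iff₀ (by positivity)] at hn
  have : (A : ℤ) * 78 ^ n < 91 ^ n := by exact_mod_cast hn
  omega

theorem window_false {x : Dg} (hY : YD x) (L : ℕ)
    (hl : ∀ n : ℤ, ∃ k : ℤ, -L ≤ k ∧ k ≤ L ∧ ∃ d, x n (2 * n + k) d ≠ none) : False := by
  classical
  set K : ℕ := 2 * L + 1 with hK
  obtain ⟨n, hn⟩ := growth (13608 * 3 * K)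
  have hb := bb_nonneg n
  set Q : ℕ := (2 * L + 2 * NN n + 2 * bb n + 1).toNat with hQ
  have hQ' : (Q : ℤ) = 2 * L + 2 * NN n + 2 * bb n + 1 := Int.toNat_of_nonneg (by omega)
  set M : ℕ := 13608 * 78 ^ n * Q + 1 with hM
  choose k k1 k2 e k3 using hl
  have hex : ∀ i : ℕ, ∃ s d, Tr x (NN n + K * i) (-NN n) s d
      (2 * (K * i : ℕ) + k (K * i : ℕ)) (e (K * i : ℕ)) := by
    intro i
    apply Tr_ex hY
    convert k3 (K * i : ℕ) using 2
    push_cast; ring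
  choose s d hT using hex
  have inj : ∀ i j : ℕ, i < j → (s i, d i) = (s j, d j) → False := by
    intro i j hij heq
    simp only [Prod.mk.injEq] at heq
    obtain ⟨m, rfl⟩ := Nat.exists_eq_add_of_lt hij
    have hj := hT (i + m + 1)
    rw [show NN n + K * (i + m + 1) = NN n + K * i + K * (m + 1) by ring] at hj
    obtain ⟨s1, d1, h1, h2⟩ := Tr_split _ _ _ _ _ _ _ hj
    rw [← heq.1, ← heq.2] at h1
    obtain ⟨h3, -⟩ := Tr_fun _ _ _ _ _ _ _ _ h1 (hT i)
    rw [h3, abs_le] at h2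
    have a1 := k1 (K * (i + m + 1) : ℕ)
    have a2 := k2 (K * i : ℕ)
    have a3 : K ≤ K * (m + 1) := Nat.le_mul_of_pos_right _ (by omega)
    have a4 : K * (i + m + 1) = K * i + K * (m + 1) := by ring
    rw [a4] at h2 a1
    generalize K * (m + 1) = Z at *
    generalize K * i = Z' at *
    push_cast at *
    omega
  have inj' : Function.Injective (fun i => (s i, d i)) := by
    intro i j h
    rcases lt_trichotomy i j with hh | hh | hh
    · exact (inj i j hh h).elim
    · exact hh
    · exact (inj j i hh h.symm).elim
  set V : Finset ℤ := (Finset.range M).image s with hV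
  have hcard : M ≤ V.card * 2 := by
    have h1 : ((Finset.range M).image (fun i => (s i, d i))).card = M := by
      rw [Finset.card_image_of_injective _ inj', Finset.card_range]
    rw [← h1]
    have h2 : (Finset.range M).image (fun i => (s i, d i)) ⊆ V ×ˢ Finset.univ := by
      intro z hz
      rw [Finset.mem_image] at hz
      obtain ⟨i, hi, rfl⟩ := hz
      simp only [Finset.mem_product, Finset.mem_univ, and_true]
      exact Finset.mem_image_of_mem _ hi
    have := Finset.card_le_card h2
    rw [Finset.card_product] at this
    simpa using this
  have hd := density hY n (-NN n) (-NN n - L) (3 * K * M + 2 * L + 2 * NN n) V (by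
    intro z hz
    rw [hV, Finset.mem_image] at hz
    obtain ⟨i, hi, rfl⟩ := hz
    have h1 := Tr_speed _ _ _ _ _ _ (hT i)
    have a1 := k1 (K * i : ℕ)
    have a2 := k2 (K * i : ℕ)
    have a3 : K * i ≤ K * M := Nat.mul_le_mul_left _ (Finset.mem_range.1 hi).le
    refine ⟨?_, ?_, d i, ?_⟩
    · rw [abs_le] at h1
      generalize K * i = Z at *
      push_cast at *
      omega
    · rw [abs_le] at h1
      rw [mul_assoc 3 K M]
      generalize K * i = Z at *
      generalize K * M = Z' at *
      push_cast at *
      omega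
    · have := Tr_surv _ 0 _ _ _ _ _ (hT i) (by
        show x _ _ _ ≠ none
        convert k3 (K * i : ℕ) using 2
        push_cast; ring)
      exact Surv_mono (by omega) this)
  have hc : (M : ℤ) ≤ V.card * 2 := by exact_mod_cast hcard
  have h91 : (0 : ℤ) ≤ 91 ^ n := by positivity
  have h78 : (0 : ℤ) ≤ 78 ^ n := by positivity
  have f1 : (M : ℤ) * 91 ^ n ≤ 13608 * 78 ^ n * (3 * K * M + Q) := by
    calc (M : ℤ) * 91 ^ n ≤ V.card * 2 * 91 ^ n := mul_le_mul_of_nonneg_right hc h91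
      _ = 2 * (V.card * 91 ^ n) := by ring
      _ ≤ 2 * (6804 * 78 ^ n * ((3 * K * M + 2 * L + 2 * NN n : ℕ) + 2 * bb n + 1)) :=
        mul_le_mul_of_nonneg_left hd (by norm_num)
      _ = _ := by rw [hQ']; push_cast; ring
  have f2 : (M : ℤ) * ((13608 * 3 * K : ℕ) * 78 ^ n + 1) ≤ M * 91 ^ n :=
    mul_le_mul_of_nonneg_left hn (by positivity)
  have f3 : (M : ℤ) = 13608 * 78 ^ n * Q + 1 := by rw [hM]; push_cast; ring
  push_cast at f2
  nlinarith

end SSCA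

namespace SSCA

abbrev St := Bool → Option C

def bl : St := fun _ => none

def F1 (d : Bool) (p : P) (h : D) : St :=
  match cls p with
  | .solo d' e' => if d' = d then (fun e => if e = e' then some (adv p e', h) else none) else bl
  | _ => bl

def F2 (o : Option (Bool → C)) : St :=
  match o with
  | some o => fun e => some (o e)
  | none => bl

def F (i : St) : St :=
  match i true, i false with
  | some (p, h), none => F1 true p h
  | none, some (p, h) => F1 false p h
  | some (p, h), some (p', h') =>
    if p = p' then F2 (gate p (fun d => if d then h else h')) else bl
  | none, none => bl

theorem F_bl : F bl = bl := rfl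

theorem F_solo {i : St} {d e : Bool} {p : P} {h : D} (h1 : i d = some (p, h)) (h2 : i (!d) = none)
    (h3 : cls p = .solo d e) : F i = fun e' => if e' = e then some (adv p e, h) else none := by
  cases d <;> simp only [Bool.not_true, Bool.not_false] at h2 <;> simp [F, F1, h1, h2, h3]

theorem F_cross {i : St} {p : P} {c : Bool → D} {o : Bool → C} (h1 : ∀ d, i d = some (p, c d))
    (h2 : gate p c = some o) : F i = fun e => some (o e) := by
  have : (fun d => if d then c true else c false) = c := by
    funext d; cases d <;> rfl
  simp only [F, h1]
  rw [if_pos trivial]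
  simp only [this, h2, F2]

theorem F1_inv {d e : Bool} {p : P} {h : D} (hh : F1 d p h e ≠ none) : cls p = .solo d e := by
  unfold F1 at hh
  rcases hc : cls p with _ | ⟨d', e'⟩ | g
  · simp [hc, bl] at hh
  · simp only [hc] at hh
    split_ifs at hh with h1
    · simp only [ne_eq, ite_eq_right_iff, reduceCtorEq, imp_false, not_not] at hh
      rw [h1, hh]
    · exact absurd rfl hh
  · simp [hc, bl] at hh

theorem F_inv {i : St} {e : Bool} (hh : F i e ≠ none) :
    (∃ d p h, i d = some (p, h) ∧ i (!d) = none ∧ cls p = .solo d e) ∨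
    (∃ p c o, (∀ d, i d = some (p, c d)) ∧ gate p c = some o) := by
  unfold F at hh
  rcases h1 : i true with _ | ⟨p, h⟩ <;> rcases h2 : i false with _ | ⟨p', h'⟩ <;>
    simp only [h1, h2] at hh
  · exact absurd rfl hh
  · exact Or.inl ⟨false, p', h', h2, h1, F1_inv hh⟩
  · exact Or.inl ⟨true, p, h, h1, h2, F1_inv hh⟩
  · split_ifs at hh with hp
    · subst hp
      rcases hg : gate p (fun d => if d then h else h') with _ | o
      · rw [hg] at hh; exact absurd rfl hh
      · refine Or.inr ⟨p, _, o, ?_, hg⟩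
        intro d; cases d <;> simp [h1, h2]
    · exact absurd rfl hh

def Ex (x : Dg) : Prop := ∀ t s e, x (t + 1) (s + sg e) e = F (x t s) e

theorem Ex_YD {x : Dg} (hx : Ex x) : YD x := by
  intro t s e h
  rw [hx] at h
  rcases F_inv h with ⟨d, p, k, h1, h2, h3⟩ | ⟨p, c, o, h1, h2⟩
  · have := F_solo h1 h2 h3
    refine ⟨d, Or.inl ⟨p, k, h1, h3, ?_, ?_⟩⟩ <;> rw [hx, this] <;> simp
  · refine ⟨!e, Or.inr ⟨⟨p, c, o, h1, h2, ?_⟩, rfl⟩⟩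
    rw [hx, F_cross h1 h2]

def Psi (X : ℤ → St) : ℤ → St := fun s e => F (X (s - sg e)) e

def Phi (X : ℤ → St) : ℤ → St := fun s => Psi X (s + 2)

theorem blank_often (y : ℤ → St) (L : ℕ) :
    ∃ n : ℕ, ∀ k : ℤ, -L ≤ k → k ≤ L → Phi^[n] y k = bl := by
  by_contra hcon
  push Not at hcon
  set U := Filter.hyperfilter ℕ
  have hz : ∀ (t k : ℤ), ∃ a : St, ∀ᶠ N : ℕ in U, Phi^[(N + t).toNat] y k = a := by
    intro t k
    have : ∀ᶠ N : ℕ in U, ∃ a : St, Phi^[(N + t).toNat] y k = a :=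
      Filter.Eventually.of_forall fun N => ⟨_, rfl⟩
    rwa [Ultrafilter.eventually_exists_iff] at this
  choose z hz using hz
  set x : Dg := fun t s => z t (s - 2 * t) with hx
  have hbig : ∀ t : ℤ, ∀ᶠ N : ℕ in U, 0 ≤ N + t := by
    intro t
    have : ∀ᶠ N : ℕ in Filter.atTop, 0 ≤ N + t := by
      filter_upwards [Filter.eventually_ge_atTop (-t).toNat] with N hN
      omega
    exact (Nat.hyperfilter_le_atTop) this
  have hEx : Ex x := by
    intro t s e
    simp only [hx]
    obtain ⟨N, h1, h2, h3⟩ := ((hbig t).and ((hz (t + 1) (s + sg e - 2 * (t + 1))).and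
      (hz t (s - 2 * t)))).exists
    rw [← h2, ← h3]
    rw [show (N + (t + 1)).toNat = (N + t).toNat + 1 by omega, Function.iterate_succ_apply']
    simp only [Phi, Psi]
    rw [show s + sg e - 2 * (t + 1) + 2 - sg e = s - 2 * t by ring]
  apply window_false (Ex_YD hEx) L
  intro n
  have hall : ∀ᶠ N : ℕ in U, ∀ k ∈ Finset.Icc (-L : ℤ) L, Phi^[(N + n).toNat] y k = z n k := by
    rw [Filter.eventually_all_finset]
    intro k _
    exact hz n k
  obtain ⟨N, hN⟩ := hall.exists
  obtain ⟨k, k1, k2, k3⟩ := hcon (N + n).toNat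
  rw [hN k (Finset.mem_Icc.2 ⟨k1, k2⟩)] at k3
  refine ⟨k, k1, k2, ?_⟩
  simp only [hx, add_sub_cancel_left]
  by_contra hne
  push Not at hne
  exact k3 (funext hne)

end SSCA

namespace SSCA

def pk : Kind → Bool
  | .solo a b => a == b
  | .hv _ => true

def lineL (κ : Kind) (ι : Bool × Bool) : List ℕ := path (ι.2 == ι.1) (pk κ)

def lp (κ : Kind) (ι : Bool × Bool) (j : ℕ) : ℤ := (mir ι.1 ((lineL κ ι).getD j 0) : ℤ) - 5

def ls (κ : Kind) (ι : Bool × Bool) (j : ℕ) : Bool := mv (lineL κ ι) (j - 1) == ι.1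

def act : Kind → Bool × Bool → Bool
  | .solo a _, ι => ι.1 == a
  | .hv _, _ => true

def hit (κ : Kind) (j : ℕ) (r : ℤ) (d : Bool) (ι : Bool × Bool) : Bool :=
  act κ ι && decide (lp κ ι j = r) && (ls κ ι j == d)

def qq (κ : Kind) (j : ℕ) (r : ℤ) (d : Bool) : Option (Bool × Bool) :=
  if hit κ j r d (true, true) then some (true, true) else
  if hit κ j r d (true, false) then some (true, false) else
  if hit κ j r d (false, true) then some (false, true) else
  if hit κ j r d (false, false) then some (false, false) else none

def lab (κ : Kind) (j : ℕ) (r : ℤ) : P :=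
  if j = 13 then (if r = 4 then Lm true else Lm false)
  else (κ, Fin.ofNat 13 j, Fin.ofNat 11 (r + 5).toNat)

def isHv : Kind → Bool
  | .hv _ => true
  | _ => false

def Chk1 (κ : Kind) (j : ℕ) (r : ℤ) : Prop :=
  (∀ d, qq κ j r d = none) ∧ ∀ e, qq κ (j + 1) (r + sg e) e = none

instance (κ j r) : Decidable (Chk1 κ j r) := by unfold Chk1; infer_instance

def Chk2 (κ : Kind) (j : ℕ) (r : ℤ) (d : Bool) (ι : Bool × Bool) (e : Bool) : Prop :=
  qq κ j r d = some ι ∧ qq κ j r (!d) = none ∧ cls (lab κ j r) = .solo d e ∧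
    qq κ (j + 1) (r + sg e) e = some ι ∧ qq κ (j + 1) (r + sg (!e)) (!e) = none ∧
    adv (lab κ j r) e = lab κ (j + 1) (r + sg e) ∧
    (isHv κ = true → (j = 3 → ι.1 ≠ ι.2) ∧ (j = 7 → ι.1 = ι.2))

instance (κ j r d ι e) : Decidable (Chk2 κ j r d ι e) := by unfold Chk2; infer_instance

def Chk3 (κ : Kind) (j : ℕ) (r : ℤ) (g : Op) : Prop :=
  κ = .hv g ∧ (
      (j = 3 ∧ cls (lab κ j r) = .cross .cmp ∧
        ∀ d, qq κ j r d = some (d, d) ∧ qq κ (j + 1) (r + sg d) d = some (d, d)) ∨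
      (j = 5 ∧ cls (lab κ j r) = .cross .pass ∧
        ∃ b, ∀ d, qq κ j r d = some (d, b) ∧ qq κ (j + 1) (r + sg d) d = some (d, b)) ∨
      (j = 7 ∧ cls (lab κ j r) = .cross g ∧
        ∀ d, qq κ j r d = some (d, !d) ∧ qq κ (j + 1) (r + sg d) d = some (d, !d)))

instance (κ j r g) : Decidable (Chk3 κ j r g) := by unfold Chk3; infer_instance

def Chk (κ : Kind) (j : ℕ) (r : ℤ) : Prop :=
  Chk1 κ j r ∨ (∃ d ι e, Chk2 κ j r d ι e) ∨
  (isM (lab κ j r) = none ∧ (∀ e, adv (lab κ j r) e = lab κ (j + 1) (r + sg e)) ∧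
    ∃ g, Chk3 κ j r g)

instance (κ j r) : Decidable (Chk κ j r) := by unfold Chk; infer_instance

theorem tab_chk : ∀ (κ : Kind) (j : Fin 12) (r : Fin 15), Chk κ (j.val + 1) ((r.val : ℤ) - 7) := by
  decide +kernel

theorem tab_supp : ∀ (κ : Kind) (j : Fin 14) (ι : Bool × Bool),
    -5 ≤ lp κ ι j.val ∧ lp κ ι j.val ≤ 5 := by
  decide +kernel

def OK (i : St) : Prop := i = bl ∨
  (∃ d p h e, i d = some (p, h) ∧ i (!d) = none ∧ cls p = .solo d e) ∨
  (∃ p c o, (∀ d, i d = some (p, c d)) ∧ gate p c = some o)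

def bx (κ : Kind) (val : ℕ → Bool × Bool → D) (j : ℕ) (r : ℤ) : St := fun d =>
  (qq κ j r d).map (fun ι => (lab κ j r, val j ι))

def VOK (κ : Kind) (val : ℕ → Bool × Bool → D) : Prop :=
  (∀ a b, κ = .solo a b → ∀ j ι, val (j + 1) ι = val j ι) ∧
  (∀ g, κ = .hv g → (∀ j d, j ≠ 3 → val (j + 1) (d, d) = val j (d, d)) ∧
    (∀ j d, j ≠ 7 → val (j + 1) (d, !d) = val j (d, !d)) ∧
    opc .cmp (fun d => val 3 (d, d)) = some (fun d => val 4 (d, d)) ∧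
    opc g (fun d => val 7 (d, !d)) = some (fun d => val 8 (d, !d)))

theorem gate_of {p : P} {c : Bool → D} {g : Op} {o : Bool → D} (h1 : cls p = .cross g)
    (h2 : isM p = none) (h3 : opc g c = some o) :
    gate p c = some (fun e => (adv p e, o e)) := by
  simp [gate, h1, kd, h2, h3, outLab]

theorem bx_supp {κ : Kind} {val : ℕ → Bool × Bool → D} {j : ℕ} (hj : j ≤ 13) {r : ℤ}
    (hr : r < -5 ∨ 5 < r) : bx κ val j r = bl := by
  have : ∀ d ι, hit κ j r d ι = false := by
    intro d ι
    have := tab_supp κ ⟨j, by omega⟩ ι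
    simp only at this
    have h : lp κ ι j ≠ r := by omega
    simp [hit, h]
  funext d
  simp [bx, qq, this, bl]

theorem bx_cross {κ : Kind} {val : ℕ → Bool × Bool → D} {j : ℕ} {r : ℤ} {g : Op}
    {ι : Bool → Bool × Bool} (h1 : cls (lab κ j r) = .cross g) (h2 : isM (lab κ j r) = none)
    (h3 : ∀ e, adv (lab κ j r) e = lab κ (j + 1) (r + sg e))
    (h4 : ∀ d, qq κ j r d = some (ι d) ∧ qq κ (j + 1) (r + sg d) d = some (ι d))
    (h5 : opc g (fun d => val j (ι d)) = some (fun d => val (j + 1) (ι d))) :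
    OK (bx κ val j r) ∧ ∀ e, bx κ val (j + 1) (r + sg e) e = F (bx κ val j r) e := by
  have k1 : ∀ d, bx κ val j r d = some (lab κ j r, val j (ι d)) := by
    intro d; simp [bx, (h4 d).1]
  have k2 := gate_of h1 h2 h5
  refine ⟨Or.inr (Or.inr ⟨_, _, _, k1, k2⟩), ?_⟩
  intro e
  rw [F_cross k1 k2]
  simp [bx, (h4 e).2, h3]

theorem bx_step {κ : Kind} {val : ℕ → Bool × Bool → D} (hv : VOK κ val) {j : ℕ} (hj1 : 1 ≤ j)
    (hj : j ≤ 12) {r : ℤ} (hr1 : -7 ≤ r) (hr2 : r ≤ 7) :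
    OK (bx κ val j r) ∧ ∀ e, bx κ val (j + 1) (r + sg e) e = F (bx κ val j r) e := by
  have hc : Chk κ j r := by
    have := tab_chk κ ⟨j - 1, by omega⟩ ⟨(r + 7).toNat, by omega⟩
    convert this using 1
    · simp only; omega
    · simp only; omega
  rcases hc with ⟨h1, h2⟩ | ⟨d, ι, e, h1, h2, h3, h4, h5, h6, h7⟩ | ⟨h1, h2, g, rfl, h3⟩
  · have : bx κ val j r = bl := by funext d; simp [bx, h1, bl]
    refine ⟨Or.inl this, fun e => ?_⟩
    rw [this, F_bl]
    simp [bx, h2, bl]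
  · have k1 : bx κ val j r d = some (lab κ j r, val j ι) := by simp [bx, h1]
    have k2 : bx κ val j r (!d) = none := by simp [bx, h2]
    refine ⟨Or.inr (Or.inl ⟨d, _, _, e, k1, k2, h3⟩), fun e' => ?_⟩
    rw [F_solo k1 k2 h3]
    by_cases he : e' = e
    · subst he
      have hval : val (j + 1) ι = val j ι := by
        rcases κ with ⟨a, b⟩ | g
        · exact hv.1 a b rfl _ _
        · obtain ⟨v1, v2, -⟩ := hv.2 g rfl
          obtain ⟨w1, w2⟩ := h7 rfl
          obtain ⟨u, v⟩ := ι
          by_cases huv : u = v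
          · subst huv
            exact v1 j u (fun h => w1 h rfl)
          · have : v = !u := by cases u <;> cases v <;> simp_all
            subst this
            exact v2 j u (fun h => huv (w2 h))
      simp [bx, h4, h6, hval]
    · have : e' = !e := by cases e <;> cases e' <;> simp_all
      subst this
      simp [bx, h5]
  · obtain ⟨v1, v2, v3, v4⟩ := hv.2 g rfl
    rcases h3 with ⟨rfl, h3, h4⟩ | ⟨rfl, h3, b, h4⟩ | ⟨rfl, h3, h4⟩
    · exact bx_cross h3 h1 h2 h4 v3
    · refine bx_cross h3 h1 h2 h4 ?_
      simp only [opc, Option.some.injEq]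
      funext d
      by_cases hb : b = d
      · subst hb; exact (v1 5 b (by norm_num)).symm
      · have : b = !d := by cases d <;> cases b <;> simp_all
        subst this; exact (v2 5 d (by norm_num)).symm
    · exact bx_cross h3 h1 h2 h4 v4

end SSCA

namespace SSCA

def es (D : Bool) (v : Option C) : St := fun d =>
  v.map (fun z => (Lm D, if d = D then z.2 else (z.1, k0)))

def b0 (i : St) (r : ℤ) : St :=
  if r = -3 then es true (i true) else if r = 3 then es false (i false) else bl

def b13 (i : St) (r : ℤ) : St :=
  if r = 4 then es true (F i true) else if r = -4 then es false (F i false) else bl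

def okD : Kind → Bool → Bool
  | .solo _ b, d => b == d
  | .hv _, _ => true

def srcD : Kind → Bool → Bool
  | .solo a _, _ => a
  | .hv _, d => d

theorem tab_st1 : ∀ (κ : Kind) (d e : Bool), act κ (d, true) = true →
    qq κ 1 (-3 * sg d + sg e) e = some (d, e) ∧
    lab κ 1 (-3 * sg d + sg e) = (κ, 1, mvA (am d) e) := by decide +kernel

theorem tab_st2 : ∀ (κ : Kind) (r : Fin 15) (e : Bool),
    (∀ d, act κ (d, true) = true → (r.val : ℤ) - 7 ≠ -3 * sg d) →
    qq κ 1 ((r.val : ℤ) - 7 + sg e) e = none := by decide +kernel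

theorem tab_en1 : ∀ (κ : Kind) (d e : Bool), okD κ d = true →
    qq κ 13 (4 * sg d) e = some (srcD κ d, !e) ∧ lab κ 13 (4 * sg d) = Lm d := by decide +kernel

theorem tab_en2 : ∀ (κ : Kind) (r : Fin 15) (e : Bool),
    (∀ d, okD κ d = true → (r.val : ℤ) - 7 ≠ 4 * sg d) →
    qq κ 13 ((r.val : ℤ) - 7) e = none := by decide +kernel

theorem b0_at (i : St) (d : Bool) : b0 i (-3 * sg d) = es d (i d) := by
  cases d <;> simp [b0, sg]

theorem b0_off (i : St) (r : ℤ) (h : ∀ d, i d ≠ none → r ≠ -3 * sg d) : b0 i r = bl := by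
  unfold b0
  split_ifs with h1 h2
  · by_cases hn : i true = none
    · rw [hn]; rfl
    · exact absurd h1 (by simpa [sg] using h true hn)
  · by_cases hn : i false = none
    · rw [hn]; rfl
    · exact absurd h2 (by simpa [sg] using h false hn)
  · rfl

theorem b13_at (i : St) (d : Bool) : b13 i (4 * sg d) = es d (F i d) := by
  cases d <;> simp [b13, sg]

theorem b13_off (i : St) (r : ℤ) (h : ∀ d, F i d ≠ none → r ≠ 4 * sg d) : b13 i r = bl := by
  unfold b13
  split_ifs with h1 h2
  · by_cases hn : F i true = none
    · rw [hn]; rfl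
    · exact absurd h1 (by simpa [sg] using h true hn)
  · by_cases hn : F i false = none
    · rw [hn]; rfl
    · exact absurd h2 (by simpa [sg] using h false hn)
  · rfl

def Box (i : St) (f : ℕ → ℤ → St) : Prop :=
  f 0 = b0 i ∧ f 13 = b13 i ∧ (∀ j, j ≤ 13 → ∀ r : ℤ, r < -5 ∨ 5 < r → f j r = bl) ∧
  ∀ j, j < 13 → ∀ r : ℤ, -7 ≤ r → r ≤ 7 →
    OK (f j r) ∧ ∀ e, f (j + 1) (r + sg e) e = F (f j r) e

theorem box_of {i : St} {κ : Kind} {val : ℕ → Bool × Bool → D} (hv : VOK κ val)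
    (h1 : ∀ d, act κ (d, true) = true → ∃ π δ, i d = some (π, δ) ∧
      gate (Lm d) (fun e => if e = d then δ else (π, k0)) =
        some (fun e => ((κ, 1, mvA (am d) e), val 1 (d, e))))
    (h2 : ∀ d, act κ (d, true) = false → i d = none)
    (h3 : ∀ d, okD κ d = true → ∃ v : C, F i d = some v ∧ val 13 (srcD κ d, !d) = v.2 ∧
      val 13 (srcD κ d, d) = (v.1, k0))
    (h4 : ∀ d, okD κ d = false → F i d = none) : ∃ f, Box i f := by
  refine ⟨fun j => if j = 0 then b0 i else bx κ val j, by simp, ?_, ?_, ?_⟩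
  · funext r
    simp only [OfNat.ofNat_ne_zero, if_false]
    by_cases hr : ∃ d, okD κ d = true ∧ r = 4 * sg d
    · obtain ⟨d, hd, rfl⟩ := hr
      rw [b13_at]
      obtain ⟨v, v1, v2, v3⟩ := h3 d hd
      funext e
      obtain ⟨t1, t2⟩ := tab_en1 κ d e hd
      simp only [bx, t1, t2, es, v1, Option.map_some]
      by_cases he : e = d
      · subst he; simp [v2]
      · have : e = !d := by cases d <;> cases e <;> simp_all
        subst this
        simp [v3]
    · push Not at hr
      rw [b13_off]
      · by_cases hr2 : r < -5 ∨ 5 < r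
        · exact bx_supp le_rfl hr2
        · have := tab_en2 κ ⟨(r + 7).toNat, by omega⟩
          have e : (((r + 7).toNat : ℕ) : ℤ) - 7 = r := by omega
          simp only [e] at this
          funext d
          simp [bx, this d hr, bl]
      · intro d hd
        apply hr
        by_contra hc
        exact hd (h4 d (by simpa using hc))
  · intro j hj r hr
    by_cases hj0 : j = 0
    · simp only [hj0, if_true]
      simp only [b0]
      rw [if_neg (by omega), if_neg (by omega)]
    · simp only [hj0, if_false]
      exact bx_supp hj hr
  · intro j hj r hr1 hr2
    by_cases hj0 : j = 0
    · subst hj0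
      simp only [if_true, zero_add, one_ne_zero, if_false]
      by_cases hr : ∃ d, act κ (d, true) = true ∧ r = -3 * sg d
      · obtain ⟨d, hd, rfl⟩ := hr
        rw [b0_at]
        obtain ⟨π, δ, k1, k2⟩ := h1 d hd
        have k3 : ∀ e, es d (i d) e = some (Lm d, if e = d then δ else (π, k0)) := by
          intro e; simp [es, k1]
        refine ⟨Or.inr (Or.inr ⟨_, _, _, k3, k2⟩), fun e => ?_⟩
        rw [F_cross k3 k2]
        obtain ⟨t1, t2⟩ := tab_st1 κ d e hd
        simp only [bx, t1, t2, Option.map_some]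
      · push Not at hr
        have : b0 i r = bl := by
          apply b0_off
          intro d hd
          apply hr
          by_contra hc
          exact hd (h2 d (by simpa using hc))
        rw [this]
        refine ⟨Or.inl rfl, fun e => ?_⟩
        have t := tab_st2 κ ⟨(r + 7).toNat, by omega⟩
        have e1 : (((r + 7).toNat : ℕ) : ℤ) - 7 = r := by omega
        simp only [e1] at t
        rw [F_bl]
        simp [bx, t e hr, bl]
    · have := bx_step hv (j := j) (r := r) (by omega) (by omega) hr1 hr2
      simpa only [hj0, if_false, Nat.succ_ne_zero] using this

theorem box_bl : ∃ f, Box bl f := by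
  refine ⟨fun _ _ => bl, ?_, ?_, ?_, ?_⟩
  · funext r; rw [b0_off]; intro d h; exact absurd rfl h
  · funext r; rw [b13_off]; intro d h; exact absurd rfl h
  · intros; rfl
  · intros; exact ⟨Or.inl rfl, fun e => rfl⟩

theorem gate_Lm {d : Bool} {c : Bool → D} {κ : Kind} {o : Bool → D}
    (h1 : disp d (c (!d)).1 = some κ) (h2 : opc (.M d) c = some o) :
    gate (Lm d) c = some (fun e => ((κ, 1, mvA (am d) e), o e)) := by
  simp [gate, cls_Lm, kd, isM_Lm, outLab, h1, h2]

theorem box_solo {i : St} {d e : Bool} {p : P} {h : D} (h1 : i d = some (p, h))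
    (h2 : i (!d) = none) (h3 : cls p = .solo d e) : ∃ f, Box i f := by
  apply box_of (κ := .solo d e)
    (val := fun _ ι => if ι.2 = e then (adv p e, k0) else h)
  · refine ⟨fun a b _ j ι => rfl, fun g hg => ?_⟩
    simp at hg
  · intro d' hd'
    simp only [act, beq_iff_eq] at hd'
    subst hd'
    refine ⟨p, h, h1, ?_⟩
    apply gate_Lm
    · simp [disp, h3]
    · simp [opc, h3]
  · intro d' hd'
    have : d' = !d := by simp only [act, beq_eq_false_iff_ne] at hd'; cases d <;> cases d' <;> simp_all
    rw [this, h2]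
  · intro d' hd'
    simp only [okD, beq_iff_eq] at hd'
    subst hd'
    refine ⟨(adv p e, h), by rw [F_solo h1 h2 h3]; simp, ?_, ?_⟩ <;> simp
  · intro d' hd'
    simp only [okD, beq_eq_false_iff_ne] at hd'
    rw [F_solo h1 h2 h3]
    simp [Ne.symm hd']

def vv (π : P) (κ : Kind) (δ o : Bool → D) (j : ℕ) (ι : Bool × Bool) : D :=
  if ι.1 = ι.2 then
    (if j ≤ 3 then (π, if isM π = some (!ι.1) then κ else k0) else (outLab π κ ι.1, k0))
  else if j ≤ 7 then δ ι.1 else o ι.1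

theorem box_hv {i : St} {p : P} {c : Bool → D} {o : Bool → C} (h1 : ∀ d, i d = some (p, c d))
    (h2 : gate p c = some o) : ∃ f, Box i f := by
  have hF := F_cross h1 h2
  obtain ⟨g, κ, o', g1, g2, g3, g4⟩ := gate_some h2
  apply box_of (κ := .hv g) (val := vv p κ c o')
  · refine ⟨fun a b hab => by simp at hab, fun g' hg' => ?_⟩
    simp only [Kind.hv.injEq] at hg'
    subst hg'
    refine ⟨?_, ?_, ?_, ?_⟩
    · intro j d hj
      have : j + 1 ≤ 3 ↔ j ≤ 3 := by omega
      simp [vv, this]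
    · intro j d hj
      have : j + 1 ≤ 7 ↔ j ≤ 7 := by omega
      simp [vv, this]
    · simp only [vv, opc]
      simp
      funext d
      rcases hm : isM p with _ | d'
      · simp [outLab, hm]
      · simp
    · simp [vv, g3]
  · intro d _
    refine ⟨p, c d, h1 d, ?_⟩
    apply gate_Lm
    · simp [disp, g1]
    · have hk : kinfo d p (c d) = some (if isM p = some (!d) then κ else k0) := by
        unfold kinfo
        rcases hm : isM p with _ | d'
        · simp
        · by_cases hd : d' = !d
          · subst hd
            simp only [kd, hm, Bool.not_not] at g2
            simp [g2]
          · simp [hd]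
      simp only [opc, Bool.not_eq_eq_eq_not, Bool.not_eq_self, if_false, g1]
      simp [hk, g1]
      funext e
      cases d <;> cases e <;> simp [vv]
  · intro d hd
    simp [act] at hd
  · intro d _
    refine ⟨o d, by rw [hF], ?_, ?_⟩
    · simp [vv, srcD, g4]
    · simp [vv, srcD, g4]
  · intro d hd
    simp [okD] at hd

theorem box_ex {i : St} (h : OK i) : ∃ f, Box i f := by
  rcases h with rfl | ⟨d, p, h, e, h1, h2, h3⟩ | ⟨p, c, o, h1, h2⟩
  · exact box_bl
  · exact box_solo h1 h2 h3
  · exact box_hv h1 h2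

end SSCA

namespace SSCA

def MF (X : ℤ → St) : Prop := ∀ s, OK (X s)

def enc (X : ℤ → St) (s : ℤ) : St :=
  if s % 7 = 4 then es true (X ((s + 3) / 7) true) else
  if s % 7 = 3 then es false (X ((s - 3) / 7) false) else bl

theorem enc_run {X : ℤ → St} (hX : MF X) :
    (∀ j, j < 13 → MF (Psi^[j] (enc X))) ∧ Psi^[13] (enc X) = enc (Psi X) := by
  choose f hf using fun s => box_ex (hX s)
  have claim : ∀ j : ℕ, j ≤ 13 → ∀ S r : ℤ, -7 ≤ r → r < 7 → (r + (j : ℤ)) % 2 = 1 →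
      Psi^[j] (enc X) (7 * S + r) = f S j r := by
    intro j
    induction j with
    | zero =>
      intro _ S r h1 h2 h3
      rw [(hf S).1]
      simp only [Function.iterate_zero, id, enc, b0]
      by_cases hr : r = -3
      · rw [if_pos (by omega), if_pos hr, show (7 * S + r + 3) / 7 = S by omega]
      · by_cases hr' : r = 3
        · rw [if_neg (by omega), if_pos (by omega), if_neg hr, if_pos hr',
            show (7 * S + r - 3) / 7 = S by omega]
        · rw [if_neg (by omega), if_neg (by omega), if_neg hr, if_neg hr']
    | succ j ih =>
      intro hj S r h1 h2 h3
      rw [Function.iterate_succ_apply']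
      funext e
      show F (Psi^[j] (enc X) (7 * S + r - sg e)) e = _
      have hs : sg e = 1 ∨ sg e = -1 := by cases e <;> simp [sg]
      have hpar : (r - sg e + j) % 2 = 1 := by
        push_cast at h3
        omega
      have hstep : -7 ≤ r - sg e → r - sg e ≤ 7 → f S (j + 1) r e = F (f S j (r - sg e)) e := by
        intro a1 a2
        have := (((hf S).2.2.2 j (by omega) (r - sg e) a1 a2).2 e)
        rwa [sub_add_cancel] at this
      by_cases hin : -7 ≤ r - sg e ∧ r - sg e < 7
      · rw [hstep hin.1 hin.2.le, show 7 * S + r - sg e = 7 * S + (r - sg e) by ring,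
          ih (by omega) S _ hin.1 hin.2 hpar]
      · have hout : f S (j + 1) r = bl := (hf S).2.2.1 _ hj r (by omega)
        rw [hout]
        have : Psi^[j] (enc X) (7 * S + r - sg e) = bl := by
          rcases hs with hs | hs
          · rw [show 7 * S + r - sg e = 7 * (S - 2) + (r - sg e + 14) by ring,
              ih (by omega) _ _ (by omega) (by omega) (by omega)]
            exact (hf _).2.2.1 _ (by omega) _ (by omega)
          · rw [show 7 * S + r - sg e = 7 * (S + 2) + (r - sg e - 14) by ring,
              ih (by omega) _ _ (by omega) (by omega) (by omega)]
            exact (hf _).2.2.1 _ (by omega) _ (by omega)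
        rw [this, F_bl]
  have dec : ∀ (j : ℕ) (s : ℤ), ∃ S r : ℤ, s = 7 * S + r ∧ -7 ≤ r ∧ r < 7 ∧ (r + j) % 2 = 1 := by
    intro j s
    by_cases h : (s % 7 + j) % 2 = 1
    · exact ⟨s / 7, s % 7, by omega, by omega, by omega, h⟩
    · exact ⟨s / 7 + 1, s % 7 - 7, by omega, by omega, by omega, by omega⟩
  constructor
  · intro j hj s
    obtain ⟨S, r, rfl, h1, h2, h3⟩ := dec j s
    rw [claim j hj.le S r h1 h2 h3]
    exact ((hf S).2.2.2 j hj r h1 h2.le).1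
  · funext s
    obtain ⟨S, r, rfl, h1, h2, h3⟩ := dec 13 s
    rw [claim 13 le_rfl S r h1 h2 h3, (hf S).2.1]
    simp only [enc, b13]
    push_cast at h3
    by_cases hr : r = 4
    · rw [if_pos hr, if_pos (by omega), show (7 * S + r + 3) / 7 = S + 1 by omega]
      simp [Psi, sg]
    · by_cases hr' : r = -4
      · rw [if_neg hr, if_pos hr', if_neg (by omega), if_pos (by omega),
          show (7 * S + r - 3) / 7 = S - 1 by omega]
        simp [Psi, sg]
      · rw [if_neg hr, if_neg hr', if_neg (by omega), if_neg (by omega)]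

theorem enc_ne {X : ℤ → St} (h : X ≠ fun _ => bl) : enc X ≠ fun _ => bl := by
  intro h0
  apply h
  funext s d
  show _ = none
  by_contra hn
  obtain ⟨z, hz⟩ := Option.ne_none_iff_exists'.1 hn
  cases d
  · have := congrFun (congrFun h0 (7 * s + 3)) true
    simp only [enc] at this
    rw [if_neg (by omega), if_pos (by omega), show (7 * s + 3 - 3) / 7 = s by omega, hz] at this
    simp [es, bl] at this
  · have := congrFun (congrFun h0 (7 * s - 3)) true
    simp only [enc] at this
    rw [if_pos (by omega), show (7 * s - 3 + 3) / 7 = s by omega, hz] at this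
    simp [es, bl] at this

def Gd (N : ℕ) (X : ℤ → St) : Prop := (∀ j, j < N → MF (Psi^[j] X)) ∧ Psi^[N] X ≠ fun _ => bl

theorem Gd_enc {N : ℕ} {X : ℤ → St} (h : Gd N X) : Gd (13 * N) (enc X) := by
  have key : ∀ q, q ≤ N → Psi^[13 * q] (enc X) = enc (Psi^[q] X) := by
    intro q
    induction q with
    | zero => intro _; rfl
    | succ q ih =>
      intro hq
      rw [show 13 * (q + 1) = 13 + 13 * q by ring, Function.iterate_add_apply, ih (by omega),
        (enc_run (h.1 q (by omega))).2, Function.iterate_succ_apply']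
  constructor
  · intro j hj
    rw [show j = j % 13 + 13 * (j / 13) by omega, Function.iterate_add_apply, key _ (by omega)]
    exact (enc_run (h.1 (j / 13) (by omega))).1 _ (Nat.mod_lt _ (by norm_num))
  · rw [key N le_rfl]
    exact enc_ne h.2

def X0 : ℤ → St := fun s =>
  if s = 0 then (fun d => if d then some ((.solo true true, 1, 3), ((k0, 0, 0), k0)) else none)
  else bl

theorem cls_X0 : cls (.solo true true, 1, 3) = .solo true true := by decide +kernel

theorem Gd_X0 : Gd 1 X0 := by
  have h0 : X0 0 true = some ((.solo true true, 1, 3), ((k0, 0, 0), k0)) := rfl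
  have h1 : X0 0 (!true) = none := rfl
  constructor
  · intro j hj s
    obtain rfl : j = 0 := by omega
    show OK (X0 s)
    by_cases hs : s = 0
    · subst hs
      exact Or.inr (Or.inl ⟨true, _, _, _, h0, h1, cls_X0⟩)
    · left; simp [X0, hs]
  · intro h
    have := congrFun (congrFun h 1) true
    simp only [Function.iterate_one, Psi] at this
    rw [show (1 : ℤ) - sg true = 0 by simp [sg], F_solo h0 h1 cls_X0] at this
    simp [bl] at this

theorem Gd_ex (n : ℕ) : ∃ X, Gd (13 ^ n) X := by
  induction n with
  | zero => exact ⟨X0, Gd_X0⟩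
  | succ n ih =>
    obtain ⟨X, hX⟩ := ih
    exact ⟨enc X, by rw [pow_succ']; exact Gd_enc hX⟩

theorem Psi_bl : Psi (fun _ => bl) = fun _ => bl := by
  funext s e; rfl

theorem Psi_ne (n : ℕ) : ∃ X, Psi^[n] X ≠ fun _ => bl := by
  obtain ⟨X, hX⟩ := Gd_ex n
  refine ⟨X, fun h => hX.2 ?_⟩
  have hlt : n < 13 ^ n := Nat.lt_pow_self (by norm_num)
  obtain ⟨m, hm⟩ := Nat.exists_eq_add_of_lt hlt
  rw [show 13 ^ n = (m + 1) + n by omega, Function.iterate_add_apply, h]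
  exact Function.iterate_fixed Psi_bl _

theorem Psi_shift (X : ℤ → St) (k : ℤ) : Psi (fun s => X (s + k)) = fun s => Psi X (s + k) := by
  funext s e
  simp only [Psi]
  rw [show s - sg e + k = s + k - sg e by ring]

theorem Phi_iter (X : ℤ → St) (n : ℕ) : Phi^[n] X = fun s => Psi^[n] X (s + 2 * n) := by
  induction n with
  | zero => funext s; simp
  | succ n ih =>
    rw [Function.iterate_succ_apply', ih, Function.iterate_succ_apply']
    funext s
    simp only [Phi]
    rw [Psi_shift]
    simp only
    congr 1
    push_cast; ring

theorem Phi_ne (n : ℕ) : ∃ X, Phi^[n] X ≠ fun _ => bl := by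
  obtain ⟨X, hX⟩ := Psi_ne n
  refine ⟨X, fun h => hX ?_⟩
  rw [Phi_iter] at h
  funext s
  have := congrFun h (s - 2 * n)
  simpa using this

end SSCA

theorem exists_not_nilpotent_orbitClosure_contains_blank :
    ∃ (m : ℕ) (B : Fin (m + 1)) (Φ : (ℤ → Fin (m + 1)) → (ℤ → Fin (m + 1))),
      Continuous Φ ∧
      (∀ x : ℤ → Fin (m + 1), Φ (fun i => x (i + 1)) = fun i => Φ x (i + 1)) ∧
      Φ (fun _ => B) = (fun _ => B) ∧
      ¬ (∃ n : ℕ, ∀ x : ℤ → Fin (m + 1), Φ^[n] x = fun _ => B) ∧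
      (∀ x : ℤ → Fin (m + 1),
        (fun _ : ℤ => B) ∈ closure {y : ℤ → Fin (m + 1) | ∃ n : ℕ, Φ^[n] x = y}) := by
  obtain ⟨m, ⟨e⟩⟩ : ∃ m, Nonempty (SSCA.St ≃ Fin (m + 1)) := by
    obtain ⟨n, ⟨e⟩⟩ := Finite.exists_equiv_fin SSCA.St
    cases n with
    | zero => exact (e SSCA.bl).elim0
    | succ m => exact ⟨m, ⟨e⟩⟩
  have hiter : ∀ (n : ℕ) (x : ℤ → Fin (m + 1)),
      (fun (x : ℤ → Fin (m + 1)) i => e (SSCA.Phi (fun k => e.symm (x k)) i))^[n] x =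
        fun i => e (SSCA.Phi^[n] (fun k => e.symm (x k)) i) := by
    intro n
    induction n with
    | zero => intro x; funext i; simp
    | succ n ih =>
      intro x
      rw [Function.iterate_succ_apply', ih, Function.iterate_succ_apply']
      simp
  refine ⟨m, e SSCA.bl, fun x i => e (SSCA.Phi (fun k => e.symm (x k)) i), ?_, ?_, ?_, ?_, ?_⟩
  · apply continuous_pi
    intro i
    have : (fun x : ℤ → Fin (m + 1) => e (SSCA.Phi (fun k => e.symm (x k)) i)) =
        (fun y : Bool → Fin (m + 1) => e (fun d => SSCA.F (e.symm (y d)) d)) ∘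
        (fun x d => x (i + 2 - SSCA.sg d)) := by
      funext x; rfl
    rw [this]
    exact continuous_of_discreteTopology.comp (by fun_prop)
  · intro x
    funext i
    show e (SSCA.Psi (fun k => (fun k => e.symm (x k)) (k + 1)) (i + 2)) = _
    have := congrFun (SSCA.Psi_shift (fun k => e.symm (x k)) 1) (i + 2)
    rw [show (fun k => (fun k => e.symm (x k)) (k + 1)) = (fun k => e.symm (x (k + 1))) from rfl]
    refine (congrArg e this).trans ?_
    show e (SSCA.Psi _ _) = e (SSCA.Psi _ (i + 1 + 2))
    rw [show i + 1 + 2 = i + 2 + 1 by ring]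
  · funext i
    simp only [Equiv.symm_apply_apply]
    rfl
  · rintro ⟨n, hn⟩
    obtain ⟨X, hX⟩ := SSCA.Phi_ne n
    apply hX
    have := hn (fun k => e (X k))
    rw [hiter] at this
    funext s
    have := congrFun this s
    simpa using this
  · intro x
    rw [mem_closure_iff]
    intro o ho hbo
    obtain ⟨I, u, hu, hsub⟩ := isOpen_pi_iff.1 ho _ hbo
    obtain ⟨L, hL⟩ : ∃ L : ℕ, ∀ k ∈ I, |k| ≤ L := by
      refine ⟨∑ k ∈ I, k.natAbs, fun k hk => ?_⟩
      have := Finset.single_le_sum (f := fun k : ℤ => k.natAbs) (fun _ _ => Nat.zero_le _) hk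
      rw [Int.abs_eq_natAbs]
      exact_mod_cast this
    obtain ⟨n, hn⟩ := SSCA.blank_often (fun k => e.symm (x k)) L
    refine ⟨_, hsub ?_, n, rfl⟩
    rw [hiter]
    intro k hk
    have hk' := abs_le.1 (hL k hk)
    simp only [hn k hk'.1 hk'.2]
    exact (hu k hk).2
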